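/- arXiv:2108.08725 — 2 statements merged into one kernel-verified Lean document; each statement's English description precedes it below -/
import Mathlib

section
/- Let k ≥ 4 be an integer and K0, C0 > 0. Let u0 : (0,∞) → (0,∞) be smooth with u0(x) = x + K0·x^{2(k−1)} + o(x^{2(k−1)}) as x → 0⁺, and such that for all x > 0: 0 ≤ u0'(x) ≤ C0, |u0''(x)| ≤ C0, and |u0''(x)| ≤ C0·x^{2k−4}. Let M > 1, 0 < t0 < M^{−2}, C1 > 0, and let u : (0,∞) × (0,t0] → (0,∞) be a smooth solution of u_t = u_{xx}/(1+u_x²) + (3/x)·u_x − 3/u with 0 ≤ u_x(x,t) ≤ C1 for all (x,t) and |u(x,t) − u0(x)| ≤ M·t·min{1, x^{2k−4}} whenever x ≥ (M/2)·√t. Then there exists C < ∞ such that |u_t(x,t)| ≤ C, and hence |u_t(x,t)|/√(1+u_x(x,t)²) ≤ C, for all (x,t) with x ≥ M·√t and 0 < t ≤ t0. -/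
open Filter Set Asymptotics

/-- `f` has value `f0`, first spatial derivative `f1` and image `Lf` under the parabolic operator
`∂ₜ - g ∂ₓ² - b ∂ₓ` at the point `(x, t)`. -/
structure HasParabolicJet (g b : ℝ) (f : ℝ → ℝ → ℝ) (x t f0 f1 Lf : ℝ) : Prop where
  val : f x t = f0
  jet : ∃ (d : ℝ → ℝ) (f2 ft : ℝ), (∀ᶠ y in nhds x, HasDerivAt (fun z => f z t) (d y) y) ∧
    d x = f1 ∧ HasDerivAt d f2 x ∧ HasDerivAt (fun s => f x s) ft t ∧ Lf = ft - g * f2 - b * f1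

namespace HasParabolicJet

variable {g b x t f0 f1 Lf k0 k1 Lk : ℝ} {f k : ℝ → ℝ → ℝ}

theorem add (hf : HasParabolicJet g b f x t f0 f1 Lf) (hk : HasParabolicJet g b k x t k0 k1 Lk) :
    HasParabolicJet g b (fun y s => f y s + k y s) x t (f0 + k0) (f1 + k1) (Lf + Lk) := by
  obtain ⟨d, f2, ft, h1, h2, h3, h4, h5⟩ := hf.jet
  obtain ⟨e, k2, kt, j1, j2, j3, j4, j5⟩ := hk.jet
  refine ⟨by rw [hf.val, hk.val], fun y => d y + e y, f2 + k2, ft + kt, ?_, by simp only [h2, j2],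
    h3.add j3, h4.add j4, by rw [h5, j5]; ring⟩
  filter_upwards [h1, j1] with y a b using a.add b

theorem mul (hf : HasParabolicJet g b f x t f0 f1 Lf) (hk : HasParabolicJet g b k x t k0 k1 Lk) :
    HasParabolicJet g b (fun y s => f y s * k y s) x t (f0 * k0) (f1 * k0 + f0 * k1)
      (f0 * Lk + k0 * Lf - 2 * g * f1 * k1) := by
  obtain ⟨d, f2, ft, h1, h2, h3, h4, h5⟩ := hf.jet
  obtain ⟨e, k2, kt, j1, j2, j3, j4, j5⟩ := hk.jet
  have hf0 := hf.val
  have hk0 := hk.val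
  refine ⟨by rw [hf0, hk0], fun y => d y * k y t + f y t * e y,
    f2 * k0 + f1 * k1 + (f1 * k1 + f0 * k2), ft * k0 + f0 * kt, ?_, by simp only [h2, j2, hf0, hk0],
    ?_, ?_, by rw [h5, j5]; ring⟩
  · filter_upwards [h1, j1] with y a b using a.mul b
  · have hfx := h1.self_of_nhds
    have hkx := j1.self_of_nhds
    have := (h3.mul hkx).add (hfx.mul j3)
    rw [h2, j2, hf0, hk0] at this
    exact this
  · have := h4.mul j4
    rw [hf0, hk0] at this
    exact this

theorem comp {φ φ' : ℝ → ℝ} {φ'' : ℝ} (hf : HasParabolicJet g b f x t f0 f1 Lf)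
    (hφ : ∀ᶠ y in nhds f0, HasDerivAt φ (φ' y) y) (hφ' : HasDerivAt φ' φ'' f0) :
    HasParabolicJet g b (fun y s => φ (f y s)) x t (φ f0) (φ' f0 * f1)
      (φ' f0 * Lf - g * φ'' * f1 ^ 2) := by
  obtain ⟨d, f2, ft, h1, h2, h3, h4, h5⟩ := hf.jet
  have hf0 := hf.val
  subst hf0
  refine ⟨rfl, fun y => φ' (f y t) * d y, φ'' * f1 * f1 + φ' (f x t) * f2,
    φ' (f x t) * ft, ?_, by simp only [h2], ?_, ?_, by rw [h5]; ring⟩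
  · have hc : ContinuousAt (fun y => f y t) x := h1.self_of_nhds.continuousAt
    filter_upwards [h1, hc.eventually hφ] with y a b using b.comp y a
  · have hfx := h1.self_of_nhds
    have := (HasDerivAt.comp x hφ' hfx).mul h3
    rw [h2] at this
    exact this
  · exact HasDerivAt.comp t hφ.self_of_nhds h4

theorem const_mul (c : ℝ) (hf : HasParabolicJet g b f x t f0 f1 Lf) :
    HasParabolicJet g b (fun y s => c * f y s) x t (c * f0) (c * f1) (c * Lf) := by
  obtain ⟨d, f2, ft, h1, h2, h3, h4, h5⟩ := hf.jet
  refine ⟨by rw [hf.val], fun y => c * d y, c * f2, c * ft, ?_, by simp only [h2], h3.const_mul c,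
    h4.const_mul c, by rw [h5]; ring⟩
  filter_upwards [h1] with y a using a.const_mul c

theorem sq (hf : HasParabolicJet g b f x t f0 f1 Lf) :
    HasParabolicJet g b (fun y s => f y s ^ 2) x t (f0 ^ 2) (2 * f0 * f1)
      (2 * f0 * Lf - 2 * g * f1 ^ 2) := by
  convert hf.mul hf using 1
  · funext y s; ring
  all_goals ring

theorem nonneg_of_isMax (hf : HasParabolicJet g b f x t f0 f1 Lf) (hg : 0 ≤ g)
    (hx : IsLocalMax (fun y => f y t) x) (ht : ∀ᶠ s in nhdsWithin t (Iio t), f x s ≤ f x t) :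
    0 ≤ Lf := by
  obtain ⟨d, f2, ft, h1, h2, h3, h4, h5⟩ := hf.jet
  have hf1 : f1 = 0 := by rw [← h2]; exact hx.hasDerivAt_eq_zero h1.self_of_nhds
  have hft : 0 ≤ ft := by
    have h6 := (hasDerivAt_iff_tendsto_slope.1 h4).mono_left
      (nhdsWithin_mono t (fun s (hs : s ∈ Iio t) => ne_of_lt hs))
    refine ge_of_tendsto h6 ?_
    filter_upwards [ht, self_mem_nhdsWithin] with s hs hs'
    rw [slope_def_field]
    exact div_nonneg_of_nonpos (by linarith) (by linarith [mem_Iio.1 hs'])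
  have hd : deriv (fun y => f y t) =ᶠ[nhds x] d := by
    filter_upwards [h1] with y a using a.deriv
  have hf2 : f2 ≤ 0 := by
    by_contra! hpos
    have hmin : IsLocalMin (fun y => f y t) x := by
      apply isLocalMin_of_deriv_deriv_pos
      · rw [hd.deriv_eq, h3.deriv]; exact hpos
      · rw [h1.self_of_nhds.deriv, h2, hf1]
      · exact h1.self_of_nhds.continuousAt
    have hc : (fun y => f y t) =ᶠ[nhds x] fun _ => f x t := by
      filter_upwards [hx, hmin] with y a b using le_antisymm a b
    have h0 : d =ᶠ[nhds x] fun _ => 0 := by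
      filter_upwards [hc.eventually_nhds, hd] with y a b
      rw [← b, EventuallyEq.deriv_eq a, deriv_const]
    have := h0.deriv_eq
    rw [h3.deriv, deriv_const] at this
    linarith
  rw [h5, hf1]
  nlinarith [mul_nonneg hg (neg_nonneg.2 hf2)]

end HasParabolicJet

/-- Weak maximum principle on the parabolic cylinder `[x₀ - 1, x₀ + 1] × [-1, 0]`. -/
theorem parabolic_max_principle {F : ℝ → ℝ → ℝ} {x0 N B : ℝ} (hN : 0 ≤ N)
    (hF : ContinuousOn (fun q : ℝ × ℝ => F q.1 q.2) (Icc (x0 - 1) (x0 + 1) ×ˢ Icc (-1) 0))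
    (hint : ∀ x ∈ Ioo (x0 - 1) (x0 + 1), ∀ t ∈ Ioc (-1 : ℝ) 0, ∃ g b f0 f1 Lf : ℝ, 0 ≤ g ∧
      HasParabolicJet g b F x t f0 f1 Lf ∧ Lf < N)
    (hbot : ∀ x ∈ Icc (x0 - 1) (x0 + 1), F x (-1) ≤ B)
    (hleft : ∀ t ∈ Icc (-1 : ℝ) 0, F (x0 - 1) t ≤ B)
    (hright : ∀ t ∈ Icc (-1 : ℝ) 0, F (x0 + 1) t ≤ B) :
    F x0 0 ≤ B + N := by
  have hcomp : IsCompact (Icc (x0 - 1) (x0 + 1) ×ˢ Icc (-1 : ℝ) 0) :=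
    isCompact_Icc.prod isCompact_Icc
  have hmem : (x0, (0 : ℝ)) ∈ Icc (x0 - 1) (x0 + 1) ×ˢ Icc (-1 : ℝ) 0 :=
    ⟨⟨by simp, by simp⟩, ⟨by norm_num, by simp⟩⟩
  have hG : ContinuousOn (fun q : ℝ × ℝ => F q.1 q.2 + (-N) * (q.2 + 1))
      (Icc (x0 - 1) (x0 + 1) ×ˢ Icc (-1) 0) := hF.add (by fun_prop)
  obtain ⟨⟨x, t⟩, ⟨hx, ht⟩, hmax⟩ := hcomp.exists_isMaxOn ⟨_, hmem⟩ hG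
  have hmax' : ∀ y ∈ Icc (x0 - 1) (x0 + 1), ∀ s ∈ Icc (-1 : ℝ) 0,
      F y s + (-N) * (s + 1) ≤ F x t + (-N) * (t + 1) := fun y hy s hs => hmax (a := (y, s)) ⟨hy, hs⟩
  simp only at hx ht
  have hend : F x t + (-N) * (t + 1) ≤ B → F x0 0 ≤ B + N := fun h => by
    have := hmax' x0 hmem.1 0 hmem.2
    linarith
  have hNt : 0 ≤ N * (t + 1) := mul_nonneg hN (by linarith [ht.1])
  by_cases hc : x ∈ Ioo (x0 - 1) (x0 + 1) ∧ t ∈ Ioc (-1 : ℝ) 0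
  · exfalso
    obtain ⟨hxi, hti⟩ := hc
    obtain ⟨g, b, f0, f1, Lf, hg, hj, hlt⟩ := hint x hxi t hti
    have hj2 : HasParabolicJet g b (fun _ s => (-N) * (s + 1)) x t ((-N) * (t + 1)) 0 (-N) := by
      refine ⟨rfl, fun _ => 0, 0, -N, Eventually.of_forall fun y => hasDerivAt_const _ _, rfl,
        hasDerivAt_const _ _, ?_, by ring⟩
      simpa using ((hasDerivAt_id t).add_const 1).const_mul (-N)
    have := (hj.add hj2).nonneg_of_isMax hg ?_ ?_
    · linarith
    · filter_upwards [Ioo_mem_nhds hxi.1 hxi.2] with y hy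
      exact hmax' y ⟨hy.1.le, hy.2.le⟩ t ht
    · filter_upwards [Ioo_mem_nhdsLT hti.1] with s hs
      exact hmax' x hx s ⟨hs.1.le, by linarith [hs.2, ht.2]⟩
  · apply hend
    by_cases h1 : t = -1
    · subst h1; linarith [hbot x hx]
    by_cases h2 : x = x0 - 1
    · subst h2; linarith [hleft t ht]
    by_cases h3 : x = x0 + 1
    · subst h3; linarith [hright t ht]
    exact absurd ⟨⟨lt_of_le_of_ne hx.1 (Ne.symm h2), lt_of_le_of_ne hx.2 h3⟩,
      lt_of_le_of_ne ht.1 (Ne.symm h1), ht.2⟩ hc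

/-- A positive solution `U` of the profile equation on `(0, ∞) × (α, β)`, together with its
derivatives `p = Uₓ`, `p1 = Uₓₓ`, `h = Uₜ`, `h1 = Uₓₜ`, `h2 = Uₓₓₜ`. -/
structure ProfileFlow (U p p1 h h1 h2 : ℝ → ℝ → ℝ) (α β : ℝ) : Prop where
  pos : ∀ x > 0, ∀ t ∈ Ioo α β, 0 < U x t
  space_U : ∀ x > 0, ∀ t ∈ Ioo α β, HasDerivAt (fun y => U y t) (p x t) x
  time_U : ∀ x > 0, ∀ t ∈ Ioo α β, HasDerivAt (fun s => U x s) (h x t) t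
  space_p : ∀ x > 0, ∀ t ∈ Ioo α β, HasDerivAt (fun y => p y t) (p1 x t) x
  time_p : ∀ x > 0, ∀ t ∈ Ioo α β, HasDerivAt (fun s => p x s) (h1 x t) t
  space_h : ∀ x > 0, ∀ t ∈ Ioo α β, HasDerivAt (fun y => h y t) (h1 x t) x
  space_h1 : ∀ x > 0, ∀ t ∈ Ioo α β, HasDerivAt (fun y => h1 y t) (h2 x t) x
  time_p1 : ∀ x > 0, ∀ t ∈ Ioo α β, HasDerivAt (fun s => p1 x s) (h2 x t) t
  eqn : ∀ x > 0, ∀ t ∈ Ioo α β,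
    h x t = p1 x t / (1 + p x t ^ 2) + 3 / x * p x t - 3 / U x t
  cont_U : ContinuousOn (fun q : ℝ × ℝ => U q.1 q.2) (Ioi 0 ×ˢ Ioo α β)
  cont_p : ContinuousOn (fun q : ℝ × ℝ => p q.1 q.2) (Ioi 0 ×ˢ Ioo α β)
  cont_h : ContinuousOn (fun q : ℝ × ℝ => h q.1 q.2) (Ioi 0 ×ˢ Ioo α β)

namespace ProfileFlow

variable {U p p1 h h1 h2 : ℝ → ℝ → ℝ} {α β x t : ℝ}

theorem jet_sub_affine (H : ProfileFlow U p p1 h h1 h2 α β) (hx : 0 < x) (ht : t ∈ Ioo α β)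
    (a c x0 : ℝ) :
    HasParabolicJet (1 / (1 + p x t ^ 2)) (3 / x) (fun y s => U y s - (c + a * (y - x0))) x t
      (U x t - (c + a * (x - x0))) (p x t - a) (3 * (a / x - 1 / U x t)) := by
  refine ⟨rfl, fun y => p y t - a, p1 x t, h x t, ?_, rfl, (H.space_p x hx t ht).sub_const a,
    (H.time_U x hx t ht).sub_const _, ?_⟩
  · filter_upwards [lt_mem_nhds hx] with y hy
    have : HasDerivAt (fun z => c + a * (z - x0)) a y := by
      simpa using (((hasDerivAt_id y).sub_const x0).const_mul a).const_add c
    exact (H.space_U y hy t ht).sub this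
  · rw [H.eqn x hx t ht]; ring

theorem jet_angle (H : ProfileFlow U p p1 h h1 h2 α β) (hx : 0 < x) (ht : t ∈ Ioo α β) :
    HasParabolicJet (1 / (1 + p x t ^ 2)) (3 / x) (fun y s => Real.arctan (p y s)) x t
      (Real.arctan (p x t)) (h x t - 3 / x * p x t + 3 / U x t)
      (3 * (p x t / (1 + p x t ^ 2)) * (1 / U x t ^ 2 - 1 / x ^ 2)) := by
  have hU := (H.pos x hx t ht).ne'
  refine ⟨rfl, fun y => h y t - 3 / y * p y t + 3 / U y t,
    h1 x t - ((0 * x - 3 * 1) / x ^ 2 * p x t + 3 / x * p1 x t)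
      + (0 * U x t - 3 * p x t) / U x t ^ 2,
    1 / (1 + p x t ^ 2) * h1 x t, ?_, rfl, ?_, (H.time_p x hx t ht).arctan, ?_⟩
  · filter_upwards [lt_mem_nhds hx] with y hy
    convert (H.space_p y hy t ht).arctan using 1
    rw [H.eqn y hy t ht]; ring
  · exact ((H.space_h x hx t ht).sub
      (((hasDerivAt_const x (3 : ℝ)).div (hasDerivAt_id x) hx.ne').mul (H.space_p x hx t ht))).add
      ((hasDerivAt_const x (3 : ℝ)).div (H.space_U x hx t ht) hU)
  · have hx' := hx.ne'
    have : 1 + p x t ^ 2 ≠ 0 := by positivity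
    rw [H.eqn x hx t ht]
    field_simp
    ring

theorem jet_speed (H : ProfileFlow U p p1 h h1 h2 α β) (hx : 0 < x) (ht : t ∈ Ioo α β) :
    HasParabolicJet (1 / (1 + p x t ^ 2)) (3 / x) h x t (h x t) (h1 x t)
      (3 * h x t / U x t ^ 2 -
        2 * (p x t / (1 + p x t ^ 2)) * (h x t - 3 / x * p x t + 3 / U x t) * h1 x t) := by
  have hU := (H.pos x hx t ht).ne'
  have hp : 1 + p x t ^ 2 ≠ 0 := by positivity
  refine ⟨rfl, fun y => h1 y t, h2 x t,
    (h2 x t * (1 + p x t ^ 2) - p1 x t * (2 * p x t * h1 x t)) / (1 + p x t ^ 2) ^ 2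
      + 3 / x * h1 x t - (0 * U x t - 3 * h x t) / U x t ^ 2, ?_, rfl, H.space_h1 x hx t ht, ?_, ?_⟩
  · filter_upwards [lt_mem_nhds hx] with y hy using H.space_h y hy t ht
  · have hden : HasDerivAt (fun s => 1 + p x s ^ 2) (2 * p x t * h1 x t) t := by
      simpa using ((H.time_p x hx t ht).pow 2).const_add 1
    have := (((H.time_p1 x hx t ht).div hden hp).add ((H.time_p x hx t ht).const_mul (3 / x))).sub
      ((hasDerivAt_const t (3 : ℝ)).div (H.time_U x hx t ht) hU)
    refine this.congr_of_eventuallyEq ?_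
    filter_upwards [isOpen_Ioo.mem_nhds ht] with s hs using H.eqn x hx s hs
  · have hx' := hx.ne'
    rw [H.eqn x hx t ht]
    field_simp
    ring

/-- The evolution equation of the mean curvature: its reaction term contains no first-order
nonlinearity. -/
theorem jet_curvature (H : ProfileFlow U p p1 h h1 h2 α β) (hx : 0 < x) (ht : t ∈ Ioo α β) :
    ∃ X, HasParabolicJet (1 / (1 + p x t ^ 2)) (3 / x)
      (fun y s => h y s * Real.cos (Real.arctan (p y s))) x t
      (h x t * Real.cos (Real.arctan (p x t))) X
      (h x t * Real.cos (Real.arctan (p x t)) *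
        ((3 / U x t ^ 2 - p x t * (3 * (p x t / (1 + p x t ^ 2)) * (1 / U x t ^ 2 - 1 / x ^ 2)))
          + 1 / (1 + p x t ^ 2) * (h x t - 3 / x * p x t + 3 / U x t) ^ 2)) := by
  have hcos := (H.jet_angle hx ht).comp (φ := Real.cos) (φ' := fun y => -Real.sin y)
    (Eventually.of_forall Real.hasDerivAt_cos) (Real.hasDerivAt_sin _).neg
  refine ⟨h1 x t * Real.cos (Real.arctan (p x t)) + h x t * (-Real.sin (Real.arctan (p x t)) *
    (h x t - 3 / x * p x t + 3 / U x t)), ?_⟩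
  convert (H.jet_speed hx ht).mul hcos using 1
  have hs : Real.sin (Real.arctan (p x t)) = p x t * Real.cos (Real.arctan (p x t)) := by
    rw [← Real.tan_mul_cos (Real.cos_arctan_pos _).ne', Real.tan_arctan]
  rw [hs]
  have hU := (H.pos x hx t ht).ne'
  have hp : 1 + p x t ^ 2 ≠ 0 := by positivity
  have hx' := hx.ne'
  field_simp
  ring

end ProfileFlow

theorem jet_cutoff {g x t x0 : ℝ} :
    HasParabolicJet g (3 / x) (fun y s => (1 - (y - x0) ^ 2) * (1 + s)) x t
      ((1 - (x - x0) ^ 2) * (1 + t)) (-2 * (x - x0) * (1 + t))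
      ((1 - (x - x0) ^ 2) + 2 * g * (1 + t) + 3 / x * (2 * (x - x0) * (1 + t))) := by
  refine ⟨rfl, fun y => -2 * (y - x0) * (1 + t), -2 * 1 * (1 + t), (1 - (x - x0) ^ 2) * 1,
    Eventually.of_forall fun y => ?_, rfl, ?_, ?_, by ring⟩
  · have := ((((hasDerivAt_id y).sub_const x0).pow 2).const_sub 1).mul_const (1 + t)
    exact this.congr_deriv (by simp)
  · exact (((hasDerivAt_id x).sub_const x0).const_mul (-2)).mul_const (1 + t)
  · exact ((hasDerivAt_id t).const_add 1).const_mul _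

/-- The gauge `1 / (9/10 - (φ - π/4)²)`, with its first two derivatives. -/
theorem HasParabolicJet.gauge {g b x t f0 f1 Lf : ℝ} {f : ℝ → ℝ → ℝ}
    (hf : HasParabolicJet g b f x t f0 f1 Lf) (h0 : (f0 - Real.pi / 4) ^ 2 < 9 / 10) :
    HasParabolicJet g b (fun y s => 1 / (9 / 10 - (f y s - Real.pi / 4) ^ 2)) x t
      (1 / (9 / 10 - (f0 - Real.pi / 4) ^ 2))
      (2 * (f0 - Real.pi / 4) * (1 / (9 / 10 - (f0 - Real.pi / 4) ^ 2)) ^ 2 * f1)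
      (2 * (f0 - Real.pi / 4) * (1 / (9 / 10 - (f0 - Real.pi / 4) ^ 2)) ^ 2 * Lf -
        g * (2 * (1 / (9 / 10 - (f0 - Real.pi / 4) ^ 2)) ^ 2 +
          8 * (f0 - Real.pi / 4) ^ 2 * (1 / (9 / 10 - (f0 - Real.pi / 4) ^ 2)) ^ 3) * f1 ^ 2) := by
  have hd : ∀ y : ℝ, HasDerivAt (fun y => 9 / 10 - (y - Real.pi / 4) ^ 2)
      (-(2 * (y - Real.pi / 4))) y := fun y => by
    simpa using (((hasDerivAt_id y).sub_const (Real.pi / 4)).pow 2).const_sub (9 / 10)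
  have hinv : ∀ y : ℝ, (y - Real.pi / 4) ^ 2 < 9 / 10 →
      HasDerivAt (fun y => 1 / (9 / 10 - (y - Real.pi / 4) ^ 2))
      (2 * (y - Real.pi / 4) * (1 / (9 / 10 - (y - Real.pi / 4) ^ 2)) ^ 2) y := fun y hy => by
    have hne : 9 / 10 - (y - Real.pi / 4) ^ 2 ≠ 0 := by linarith
    exact ((hasDerivAt_const y (1 : ℝ)).div (hd y) hne).congr_deriv (by field_simp; ring)
  refine hf.comp (φ := fun y => 1 / (9 / 10 - (y - Real.pi / 4) ^ 2))
    (φ' := fun y => 2 * (y - Real.pi / 4) * (1 / (9 / 10 - (y - Real.pi / 4) ^ 2)) ^ 2) ?_ ?_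
  · have hc : Continuous fun y : ℝ => (y - Real.pi / 4) ^ 2 := by fun_prop
    filter_upwards [hc.continuousAt.eventually_lt_const h0] with y hy using hinv y hy
  · exact ((((hasDerivAt_id f0).sub_const (Real.pi / 4)).const_mul 2).mul
      ((hinv f0 h0).pow 2)).congr_deriv (by
        simp only [Pi.pow_apply, id]
        generalize 1 / (9 / 10 - (f0 - Real.pi / 4) ^ 2) = m
        norm_num
        ring)

theorem HasParabolicJet.sub_const {g b x t f0 f1 Lf : ℝ} {f : ℝ → ℝ → ℝ}
    (hf : HasParabolicJet g b f x t f0 f1 Lf) (c : ℝ) :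
    HasParabolicJet g b (fun y s => f y s - c) x t (f0 - c) f1 Lf := by
  obtain ⟨d, f2, ft, h1, h2, h3, h4, h5⟩ := hf.jet
  refine ⟨by rw [hf.val], d, f2, ft, ?_, h2, h3, h4.sub_const c, h5⟩
  filter_upwards [h1] with y a using a.sub_const c

theorem abs_arctan_sub_le (a b : ℝ) : |Real.arctan a - Real.arctan b| ≤ |a - b| := by
  have := Convex.norm_image_sub_le_of_norm_deriv_le (f := Real.arctan) (C := 1) (s := univ)
    (fun x _ => Real.differentiableAt_arctan x) (fun x _ => ?_) convex_univ (mem_univ b) (mem_univ a)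
  · simpa using this
  · rw [Real.deriv_arctan, Real.norm_of_nonneg (by positivity), div_le_one (by positivity)]
    nlinarith [sq_nonneg x]

/-- Pointwise bound for the localized, gauged square of the mean curvature. -/
theorem localized_curvature_le {η η1 l K X z τ m g S V V0 S0 : ℝ} (hη0 : 0 ≤ η) (hη : η ≤ 1)
    (hη1 : η1 ^ 2 ≤ 4) (hl : l ≤ 9) (hm : 10 / 9 ≤ m) (hm4 : m ≤ 4) (hτ : τ ^ 2 ≤ 1)
    (hg0 : 0 ≤ g) (hg : g ≤ 1) (hV : V ≤ V0) (hV0 : 0 ≤ V0) (hS : |S| ≤ S0) :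
    (η ^ 2) ^ 2 * (K ^ 2 * (2 * τ * m ^ 2 * S - g * (2 * m ^ 2 + 8 * τ ^ 2 * m ^ 3) * z ^ 2) +
        m * (2 * K * (K * (V + g * z ^ 2)) - 2 * g * X ^ 2) -
        2 * g * (2 * K * X) * (2 * τ * m ^ 2 * z)) +
      K ^ 2 * m * (2 * η ^ 2 * (2 * η * l - 2 * g * η1 ^ 2) - 2 * g * (2 * η * η1) ^ 2) -
      2 * g * (2 * η ^ 2 * (2 * η * η1)) * (2 * K * X * m + K ^ 2 * (2 * τ * m ^ 2 * z)) ≤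
    (8 * V0 + 32 * S0 + 75000) * (η ^ 2 * K ^ 2) := by
  have hm0 : 0 ≤ m := by linarith
  have hη2 : η ^ 2 ≤ 1 := by nlinarith
  have hηK : 0 ≤ η ^ 2 * K ^ 2 := by positivity
  have hS0 : 0 ≤ S0 := (abs_nonneg S).trans hS
  have hm2 : m ^ 2 ≤ 16 := by nlinarith
  have hm3 : m ^ 3 ≤ 64 := by nlinarith
  have hτS : τ * S ≤ S0 := by
    have h1 : |τ| ≤ 1 := by rw [← sq_le_one_iff_abs_le_one]; exact hτ
    calc τ * S ≤ |τ * S| := le_abs_self _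
      _ = |τ| * |S| := abs_mul _ _
      _ ≤ 1 * S0 := mul_le_mul h1 hS (abs_nonneg _) zero_le_one
      _ = S0 := one_mul _
  have e1 : η ^ 2 * (2 * m * V + 2 * m ^ 2 * (τ * S)) ≤ 8 * V0 + 32 * S0 := by
    have h1 : 2 * m * V + 2 * m ^ 2 * (τ * S) ≤ 2 * m * V0 + 2 * m ^ 2 * S0 := by gcongr
    have h2 : 2 * m * V0 + 2 * m ^ 2 * S0 ≤ 2 * 4 * V0 + 2 * 16 * S0 := by gcongr
    calc η ^ 2 * (2 * m * V + 2 * m ^ 2 * (τ * S)) ≤ η ^ 2 * (8 * V0 + 32 * S0) :=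
          mul_le_mul_of_nonneg_left (by linarith) (sq_nonneg η)
      _ ≤ 1 * (8 * V0 + 32 * S0) := by gcongr
      _ = _ := one_mul _
  have e2 : 4 * m * (η * l) ≤ 144 := by
    have : η * l ≤ 9 := by nlinarith
    nlinarith
  have hgη : g * η1 ^ 2 ≤ 4 := by nlinarith [sq_nonneg η1]
  have hgη0 : 0 ≤ g * η1 ^ 2 := by positivity
  have e3 : 32 * m * (g * η1 ^ 2) ≤ 512 := by
    nlinarith [mul_le_mul hm4 hgη hgη0 (by norm_num)]
  have e4 : 288 * (m ^ 3 * (g * η1 ^ 2)) * τ ^ 2 ≤ 73728 := by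
    have h1 : m ^ 3 * (g * η1 ^ 2) ≤ 64 * 4 := mul_le_mul hm3 hgη hgη0 (by norm_num)
    have h2 : 0 ≤ m ^ 3 * (g * η1 ^ 2) := by positivity
    nlinarith [mul_le_mul h1 hτ (sq_nonneg τ) (by norm_num)]
  have e5 : 0 ≤ 12 * m * (g * η1 ^ 2) := by positivity
  have key := mul_le_mul_of_nonneg_left
    (add_le_add (add_le_add (add_le_add e1 e2) e3) e4) hηK
  have q1 : 0 ≤ g * (2 * m * (η ^ 2 * (X + 2 * τ * m * (K * z)) + 4 * η * η1 * K) ^ 2) := by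
    positivity
  have q2 : 0 ≤ g * (2 * m / 9 * (η ^ 2 * (K * z) - 36 * η * η1 * m * τ * K) ^ 2) := by
    positivity
  have q3 : 0 ≤ g * (2 * m * (m - 10 / 9) * (η ^ 2 * (K * z)) ^ 2) := by
    have : 0 ≤ m - 10 / 9 := by linarith
    positivity
  have q5 := mul_nonneg hηK e5
  linarith

/-- Pointwise bound for the localized square of the angle function. -/
theorem localized_angle_le {η η1 l θ z g S : ℝ} (hη0 : 0 ≤ η) (hη : η ≤ 1) (hη1 : η1 ^ 2 ≤ 4)
    (hl : l ≤ 9) (hg0 : 0 ≤ g) (hg : g ≤ 1) :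
    η ^ 2 * (2 * θ * S - 2 * g * z ^ 2) + θ ^ 2 * (2 * η * l - 2 * g * η1 ^ 2) -
      2 * g * (2 * η * η1) * (2 * θ * z) ≤ 83 * θ ^ 2 + S ^ 2 - g * (η ^ 2 * z ^ 2) := by
  have hη2 : η ^ 2 ≤ 1 := by nlinarith
  have h1 : η ^ 2 * (2 * θ * S) ≤ θ ^ 2 + S ^ 2 := by
    have h2 : 2 * θ * S ≤ θ ^ 2 + S ^ 2 := by nlinarith [sq_nonneg (θ - S)]
    calc η ^ 2 * (2 * θ * S) ≤ η ^ 2 * (θ ^ 2 + S ^ 2) := by gcongr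
      _ ≤ 1 * (θ ^ 2 + S ^ 2) := by gcongr
      _ = _ := one_mul _
  have hgη : g * η1 ^ 2 ≤ 4 := by nlinarith [sq_nonneg η1]
  have hgη0 : 0 ≤ g * η1 ^ 2 := by positivity
  have h3 : η * l ≤ 9 := by nlinarith
  have h4 := mul_le_mul_of_nonneg_left h3 (sq_nonneg θ)
  have h5 := mul_le_mul_of_nonneg_left hgη (sq_nonneg θ)
  have h6 := mul_nonneg (sq_nonneg θ) hgη0
  have h7 : 0 ≤ g * (η * z + 4 * η1 * θ) ^ 2 := by positivity
  linarith

theorem abs_angle_source_le {p U x A ε C1 : ℝ} (hp0 : 0 ≤ p) (hpC : p ≤ C1) (hx : 1 ≤ x)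
    (hU : 0 < U) (hUx : |1 / U - 1 / x| ≤ A * ε) (hUA : 1 / U ≤ A) :
    |3 * (p / (1 + p ^ 2)) * (1 / U ^ 2 - 1 / x ^ 2)| ≤ 3 * C1 * (A * (A + 1)) * ε := by
  have hxpos : 0 < x := by linarith
  have e1 : 3 * (p / (1 + p ^ 2)) ≤ 3 * C1 := by
    have : p / (1 + p ^ 2) ≤ C1 := by
      rw [div_le_iff₀ (by positivity)]
      nlinarith [mul_nonneg (hp0.trans hpC) (sq_nonneg p)]
    linarith
  have e2 : 1 / U ^ 2 - 1 / x ^ 2 = (1 / U - 1 / x) * (1 / U + 1 / x) := by ring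
  have e3 : 1 / U + 1 / x ≤ A + 1 := by
    have : 1 / x ≤ 1 := by rw [div_le_one hxpos]; exact hx
    linarith
  have e4 : 0 ≤ 1 / U + 1 / x := by positivity
  have e5 : 0 ≤ 3 * (p / (1 + p ^ 2)) := by positivity
  rw [e2, abs_mul, abs_of_nonneg e5, abs_mul, abs_of_nonneg e4]
  calc 3 * (p / (1 + p ^ 2)) * (|1 / U - 1 / x| * (1 / U + 1 / x))
      ≤ 3 * C1 * (A * ε * (A + 1)) :=
        mul_le_mul e1 (mul_le_mul hUx e3 e4 ((abs_nonneg _).trans hUx))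
          (mul_nonneg (abs_nonneg _) e4) (e5.trans e1)
    _ = _ := by ring

theorem cutoff_bounds {x t x0 g : ℝ} (hx : x ∈ Ioo (x0 - 1) (x0 + 1)) (ht : t ∈ Ioc (-1 : ℝ) 0)
    (hx1 : 1 ≤ x) (hg1 : g ≤ 1) :
    0 ≤ (1 - (x - x0) ^ 2) * (1 + t) ∧ (1 - (x - x0) ^ 2) * (1 + t) ≤ 1 ∧
      (-2 * (x - x0) * (1 + t)) ^ 2 ≤ 4 ∧
      (1 - (x - x0) ^ 2) + 2 * g * (1 + t) + 3 / x * (2 * (x - x0) * (1 + t)) ≤ 9 := by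
  have hxpos : 0 < x := by linarith
  have ht0 : 0 ≤ 1 + t := by linarith [ht.1]
  have ht1 : 1 + t ≤ 1 := by linarith [ht.2]
  have hy2 : (x - x0) ^ 2 ≤ 1 := by nlinarith [hx.1, hx.2]
  have ht2 : (1 + t) ^ 2 ≤ 1 := by nlinarith
  refine ⟨mul_nonneg (by linarith) ht0,
    mul_le_one₀ (by linarith [sq_nonneg (x - x0)]) ht0 ht1, ?_, ?_⟩
  · have := mul_le_one₀ hy2 (sq_nonneg _) ht2
    linarith
  · have h3x : 3 / x ≤ 3 := by rw [div_le_iff₀ hxpos]; linarith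
    have h3x0 : 0 ≤ 3 / x := by positivity
    have e1 : g * (1 + t) ≤ 1 := mul_le_one₀ hg1 ht0 ht1
    have e2 : (x - x0) * (1 + t) ≤ 1 := mul_le_one₀ (by linarith [hx.2]) ht0 ht1
    have e3 : 3 / x * (2 * ((x - x0) * (1 + t))) ≤ 6 := by
      calc 3 / x * (2 * ((x - x0) * (1 + t))) ≤ 3 / x * 2 :=
            mul_le_mul_of_nonneg_left (by linarith) h3x0
        _ ≤ 6 := by linarith
    linarith [sq_nonneg (x - x0)]

/-- Summing the three localized quantities with suitable weights, the good gradient terms absorb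
everything that is not of size `ε²`. -/
theorem weighted_sum_lt {η h K θ q S W E z g g0 y A B R l1 l2 ε L1 L2 : ℝ} (hε : 0 < ε)
    (hη0 : 0 ≤ η) (hη : η ≤ 1) (hg0 : 0 < g0) (hgg0 : g0 ≤ g) (hg : g ≤ 1)
    (hl1 : 2 * R = l1 * g0) (hl2 : 101 * l1 = l2 * (2 * g0)) (hl1pos : 0 ≤ l1) (hl2pos : 0 ≤ l2)
    (hR : 0 ≤ R) (hy0 : 0 ≤ y) (hy : y ≤ 3)
    (hK : K ^ 2 ≤ h ^ 2) (hθ : θ ^ 2 ≤ q ^ 2) (hS : S ^ 2 ≤ B ^ 2 * ε ^ 2)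
    (hW : W ^ 2 ≤ A ^ 2 * ε ^ 2) (hE : E ^ 2 ≤ 9 * A ^ 2 * ε ^ 2) (hz : z = h - E - y * q)
    (hL1 : L1 ≤ R * (η ^ 2 * K ^ 2)) (hL2 : L2 ≤ 83 * θ ^ 2 + S ^ 2 - g * (η ^ 2 * z ^ 2)) :
    L1 + l1 * L2 + l2 * (2 * W * E - 2 * g * q ^ 2) <
      (l1 * (B ^ 2 + 18 * A ^ 2) + l2 * (10 * A ^ 2) + 1) * ε ^ 2 := by
  have hη2 : η ^ 2 ≤ 1 := by nlinarith
  have hε2 : 0 < ε ^ 2 := by positivity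
  have hzsq : h ^ 2 / 2 - 2 * E ^ 2 - 18 * q ^ 2 ≤ z ^ 2 := by
    have h1 : y ^ 2 * q ^ 2 ≤ 9 * q ^ 2 :=
      mul_le_mul_of_nonneg_right (by nlinarith) (sq_nonneg q)
    rw [hz]
    nlinarith [sq_nonneg (h - 2 * (E + y * q)), sq_nonneg (E - y * q)]
  have hz2 : g0 * (η ^ 2 * h ^ 2) / 2 - 2 * E ^ 2 - 18 * q ^ 2 ≤ g * (η ^ 2 * z ^ 2) := by
    have h1 := mul_le_mul_of_nonneg_left hzsq (mul_nonneg (hg0.le.trans hgg0) (sq_nonneg η))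
    have h2 : g0 * (η ^ 2 * h ^ 2) ≤ g * (η ^ 2 * h ^ 2) :=
      mul_le_mul_of_nonneg_right hgg0 (by positivity)
    have h3 : g * η ^ 2 ≤ 1 := mul_le_one₀ hg (sq_nonneg _) hη2
    have h4 : g * η ^ 2 * (2 * E ^ 2 + 18 * q ^ 2) ≤ 2 * E ^ 2 + 18 * q ^ 2 :=
      mul_le_of_le_one_left (by positivity) h3
    linarith
  have hL2' : L2 ≤ 101 * q ^ 2 + B ^ 2 * ε ^ 2 + 18 * A ^ 2 * ε ^ 2
      - g0 * (η ^ 2 * h ^ 2) / 2 := by linarith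
  have h1 := mul_le_mul_of_nonneg_left hL2' hl1pos
  have hL3 : 2 * W * E - 2 * g * q ^ 2 ≤ 10 * A ^ 2 * ε ^ 2 - 2 * g0 * q ^ 2 := by
    have := mul_le_mul_of_nonneg_right hgg0 (sq_nonneg q)
    nlinarith [sq_nonneg (W - E)]
  have h2 := mul_le_mul_of_nonneg_left hL3 hl2pos
  have h3 : R * (η ^ 2 * K ^ 2) ≤ R * (η ^ 2 * h ^ 2) := by gcongr
  have h4 : 2 * R * (η ^ 2 * h ^ 2) = l1 * g0 * (η ^ 2 * h ^ 2) := by rw [hl1]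
  have h5 : 101 * l1 * q ^ 2 = l2 * (2 * g0) * q ^ 2 := by rw [hl2]
  linarith

/-- The weighted sum of the localized squares of the curvature, of the angle and of the height over
an affine function. -/
noncomputable def localizedEnergy (U p h : ℝ → ℝ → ℝ) (x0 a c l1 l2 y s : ℝ) : ℝ :=
  ((((1 - (y - x0) ^ 2) * (1 + s)) ^ 2) ^ 2 *
      ((h y s * Real.cos (Real.arctan (p y s))) ^ 2 *
        (1 / (9 / 10 - (Real.arctan (p y s) - Real.pi / 4) ^ 2))) +
    l1 * (((1 - (y - x0) ^ 2) * (1 + s)) ^ 2 * (Real.arctan (p y s) - Real.arctan a) ^ 2)) +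
    l2 * (U y s - (c + a * (y - x0))) ^ 2

theorem curvature_potential_le {p U S A C1 S1 : ℝ} (hp0 : 0 ≤ p) (hpC : p ≤ C1) (hU : 0 < U)
    (hUA : 1 / U ≤ A) (hS : |S| ≤ S1) : 3 / U ^ 2 - p * S ≤ 3 * A ^ 2 + C1 * S1 := by
  have e1 : 3 / U ^ 2 ≤ 3 * A ^ 2 := by
    have := pow_le_pow_left₀ (by positivity) hUA 2
    calc 3 / U ^ 2 = 3 * (1 / U) ^ 2 := by ring
      _ ≤ _ := by gcongr
  have e2 : p * (-S) ≤ C1 * S1 :=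
    calc p * (-S) ≤ p * S1 := mul_le_mul_of_nonneg_left ((neg_le_abs S).trans hS) hp0
      _ ≤ _ := mul_le_mul_of_nonneg_right hpC ((abs_nonneg S).trans hS)
  linarith

theorem sq_arctan_sub_le {p : ℝ} (hp : 0 ≤ p) : (Real.arctan p - Real.pi / 4) ^ 2 ≤ 13 / 20 := by
  have h1 := Real.arctan_nonneg.2 hp
  have h2 := Real.arctan_lt_pi_div_two p
  have h3 := Real.pi_lt_d2
  nlinarith

/-- Under the heat-type operator the localized energy has a source of size at most `ε²`. -/
theorem exists_jet_localizedEnergy_lt {U p p1 h h1 h2 : ℝ → ℝ → ℝ}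
    {α β x t x0 a c ε A C1 S0 R g0 l1 l2 : ℝ} (H : ProfileFlow U p p1 h h1 h2 α β)
    (hx0 : 2 ≤ x0) (hx : x ∈ Ioo (x0 - 1) (x0 + 1)) (ht : t ∈ Ioc (-1 : ℝ) 0) (htα : t ∈ Ioo α β)
    (hε : 0 < ε) (hε1 : ε ≤ 1) (hp0 : 0 ≤ p x t) (hpC : p x t ≤ C1)
    (hWA : |U x t - (c + a * (x - x0))| ≤ A * ε) (hUx : |1 / U x t - 1 / x| ≤ A * ε)
    (haU : |a / x - 1 / U x t| ≤ A * ε) (hUA : 1 / U x t ≤ A)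
    (hS0 : S0 = 3 * C1 * (A * (A + 1)))
    (hR : R = 8 * (3 * A ^ 2 + C1 * |S0|) + 32 * |S0| + 75000) (hg0 : g0 = 1 / (1 + C1 ^ 2))
    (hl1 : 2 * R = l1 * g0) (hl2 : 101 * l1 = l2 * (2 * g0))
    (hl1pos : 0 ≤ l1) (hl2pos : 0 ≤ l2) :
    ∃ g b f0 f1 Lf : ℝ, 0 ≤ g ∧
      HasParabolicJet g b (localizedEnergy U p h x0 a c l1 l2) x t f0 f1 Lf ∧
      Lf < (l1 * (S0 ^ 2 + 18 * A ^ 2) + l2 * (10 * A ^ 2) + 1) * ε ^ 2 := by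
  have hC1 : 0 ≤ C1 := hp0.trans hpC
  have hRpos : 0 ≤ R := by rw [hR]; positivity
  have hg0pos : 0 < g0 := by rw [hg0]; positivity
  have hx1 : 1 ≤ x := by linarith [hx.1]
  have hxpos : 0 < x := by linarith
  have hτx := sq_arctan_sub_le hp0
  have hUpos := H.pos x hxpos t htα
  obtain ⟨X, jK⟩ := H.jet_curvature hxpos htα
  have jθ := H.jet_angle hxpos htα
  have jη := jet_cutoff (g := 1 / (1 + p x t ^ 2)) (x := x) (t := t) (x0 := x0)
  have j1 := jη.sq.sq.mul (jK.sq.mul (jθ.gauge (hτx.trans_lt (by norm_num))))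
  have j2 := (jη.sq.mul (jθ.sub_const (Real.arctan a)).sq).const_mul l1
  have j3 := (H.jet_sub_affine hxpos htα a c x0).sq.const_mul l2
  have hsq : ∀ y : ℝ, |y| ≤ A * ε → y ^ 2 ≤ A ^ 2 * ε ^ 2 := fun y hy => by
    rw [← mul_pow, ← sq_abs]
    exact pow_le_pow_left₀ (abs_nonneg _) hy 2
  have hθq : (Real.arctan (p x t) - Real.arctan a) ^ 2 ≤ (p x t - a) ^ 2 := by
    rw [sq_le_sq]; exact abs_arctan_sub_le _ _
  have hK : (h x t * Real.cos (Real.arctan (p x t))) ^ 2 ≤ h x t ^ 2 := by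
    rw [mul_pow]
    exact mul_le_of_le_one_right (sq_nonneg _) (Real.cos_sq_le_one _)
  have hz : h x t - 3 / x * p x t + 3 / U x t =
      h x t - 3 * (a / x - 1 / U x t) - 3 / x * (p x t - a) := by ring
  have h3x : 3 / x ≤ 3 := by rw [div_le_iff₀ hxpos]; linarith
  have h3x0 : 0 ≤ 3 / x := by positivity
  have hE : (3 * (a / x - 1 / U x t)) ^ 2 ≤ 9 * A ^ 2 * ε ^ 2 := by
    rw [mul_pow, mul_assoc]
    linarith [hsq _ haU]
  have hg1 : 1 / (1 + p x t ^ 2) ≤ 1 := by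
    rw [div_le_one (by positivity)]
    exact le_add_of_nonneg_right (sq_nonneg _)
  have hgpos : 0 ≤ 1 / (1 + p x t ^ 2) := by positivity
  have hgg0 : g0 ≤ 1 / (1 + p x t ^ 2) := by
    rw [hg0]; gcongr
  have hS := abs_angle_source_le hp0 hpC hx1 hUpos hUx hUA
  rw [← hS0] at hS
  obtain ⟨S, hSd⟩ : ∃ S, S = 3 * (p x t / (1 + p x t ^ 2)) * (1 / U x t ^ 2 - 1 / x ^ 2) :=
    ⟨_, rfl⟩
  rw [← hSd] at hS jK jθ j1 j2
  have hS2 : S ^ 2 ≤ S0 ^ 2 * ε ^ 2 := by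
    rw [← mul_pow, ← sq_abs]; exact pow_le_pow_left₀ (abs_nonneg _) hS 2
  have hS1 : |S| ≤ |S0| := by
    have : S0 * ε ≤ |S0| * 1 := mul_le_mul (le_abs_self _) hε1 hε.le (abs_nonneg _)
    linarith
  have hV := curvature_potential_le hp0 hpC hUpos hUA hS1
  obtain ⟨hη0, hη1, hη2, hL⟩ := cutoff_bounds hx ht hx1 hg1
  have hm1 : 10 / 9 ≤ 1 / (9 / 10 - (Real.arctan (p x t) - Real.pi / 4) ^ 2) := by
    rw [le_div_iff₀ (by linarith)]
    linarith [sq_nonneg (Real.arctan (p x t) - Real.pi / 4)]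
  have hm4 : 1 / (9 / 10 - (Real.arctan (p x t) - Real.pi / 4) ^ 2) ≤ 4 := by
    rw [div_le_iff₀ (by linarith)]; linarith
  have b1 := localized_curvature_le (K := h x t * Real.cos (Real.arctan (p x t))) (X := X)
    (z := h x t - 3 / x * p x t + 3 / U x t) hη0 hη1 hη2 hL hm1 hm4
    (hτx.trans (by norm_num)) hgpos hg1 hV (by positivity) hS1
  have b2 := localized_angle_le (θ := Real.arctan (p x t) - Real.arctan a) (S := S)
    (z := h x t - 3 / x * p x t + 3 / U x t) hη0 hη1 hη2 hL hgpos hg1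
  rw [← hR] at b1
  refine ⟨1 / (1 + p x t ^ 2), 3 / x, _, _, _, hgpos, (j1.add j2).add j3, ?_⟩
  exact weighted_sum_lt hε hη0 hη1 hg0pos hgg0 hg1 hl1 hl2 hl1pos hl2pos hRpos h3x0 h3x hK hθq
    hS2 (hsq _ hWA) hE hz b1 b2

/-- Interior estimate on a unit parabolic cylinder: the speed of a solution of the profile equation
is controlled linearly by its distance to an affine function and to the cone `U = x`. -/
theorem interior_speed_estimate (A C1 : ℝ) (hC1 : 0 ≤ C1) :
    ∃ C : ℝ, ∀ (U p p1 h h1 h2 : ℝ → ℝ → ℝ) (α β x0 a c ε : ℝ),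
      ProfileFlow U p p1 h h1 h2 α β → α < -1 → 0 < β → 2 ≤ x0 → 0 < ε → ε ≤ 1 →
      (∀ x ∈ Icc (x0 - 1) (x0 + 1), ∀ t ∈ Icc (-1 : ℝ) 0,
        0 ≤ p x t ∧ p x t ≤ C1 ∧ |U x t - (c + a * (x - x0))| ≤ A * ε ∧
        |1 / U x t - 1 / x| ≤ A * ε ∧ |a / x - 1 / U x t| ≤ A * ε ∧ 1 / U x t ≤ A) →
      |h x0 0| ≤ C * ε := by
  obtain ⟨S0, hS0⟩ : ∃ S0, S0 = 3 * C1 * (A * (A + 1)) := ⟨_, rfl⟩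
  obtain ⟨R, hR⟩ : ∃ R, R = 8 * (3 * A ^ 2 + C1 * |S0|) + 32 * |S0| + 75000 := ⟨_, rfl⟩
  have hRpos : 0 ≤ R := by rw [hR]; positivity
  obtain ⟨g0, hg0⟩ : ∃ g0, g0 = 1 / (1 + C1 ^ 2) := ⟨_, rfl⟩
  have hg0pos : 0 < g0 := by rw [hg0]; positivity
  obtain ⟨l1, hl1⟩ : ∃ l1, l1 = 2 * R / g0 := ⟨_, rfl⟩
  obtain ⟨l2, hl2⟩ : ∃ l2, l2 = 101 * l1 / (2 * g0) := ⟨_, rfl⟩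
  obtain ⟨N, hN⟩ : ∃ N, N = l1 * (S0 ^ 2 + 18 * A ^ 2) + l2 * (10 * A ^ 2) + 1 := ⟨_, rfl⟩
  have hl1pos : 0 ≤ l1 := by rw [hl1]; positivity
  have hl2pos : 0 ≤ l2 := by rw [hl2]; positivity
  have hRl : 2 * R = l1 * g0 := by rw [hl1]; field_simp
  have hl2l : 101 * l1 = l2 * (2 * g0) := by rw [hl2]; field_simp
  have hNpos : 0 ≤ N := by rw [hN]; positivity
  refine ⟨Real.sqrt ((l2 * A ^ 2 + N) * (1 + C1 ^ 2)), ?_⟩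
  intro U p p1 h h1 h2 α β x0 a c ε H hα hβ hx0 hε hε1 hb
  have hsub : Icc (x0 - 1) (x0 + 1) ×ˢ Icc (-1 : ℝ) 0 ⊆ Ioi 0 ×ˢ Ioo α β := fun q hq =>
    ⟨by have := hq.1.1; simp only [mem_Ioi]; linarith,
      by have := hq.2.1; linarith, by have := hq.2.2; linarith⟩
  obtain ⟨F, hF⟩ : ∃ F, F = localizedEnergy U p h x0 a c l1 l2 := ⟨_, rfl⟩
  have hW : ∀ x ∈ Icc (x0 - 1) (x0 + 1), ∀ t ∈ Icc (-1 : ℝ) 0,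
      (U x t - (c + a * (x - x0))) ^ 2 ≤ A ^ 2 * ε ^ 2 := fun x hx t ht => by
    rw [← mul_pow, ← sq_abs]
    exact pow_le_pow_left₀ (abs_nonneg _) (hb x hx t ht).2.2.1 2
  have hbd : ∀ x ∈ Icc (x0 - 1) (x0 + 1), ∀ t ∈ Icc (-1 : ℝ) 0,
      (1 - (x - x0) ^ 2) * (1 + t) = 0 → F x t ≤ l2 * A ^ 2 * ε ^ 2 := fun x hx t ht h0 => by
    have := mul_le_mul_of_nonneg_left (hW x hx t ht) hl2pos
    simp only [hF, localizedEnergy, h0]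
    linarith
  have hmem0 : x0 ∈ Icc (x0 - 1) (x0 + 1) := ⟨by linarith, by linarith⟩
  have hmax : F x0 0 ≤ l2 * A ^ 2 * ε ^ 2 + N * ε ^ 2 := by
    refine parabolic_max_principle (by positivity) ?_ ?_
      (fun x hx => hbd x hx _ (by norm_num) (by ring))
      (fun t ht => hbd _ ⟨le_rfl, by linarith⟩ t ht (by ring))
      (fun t ht => hbd _ ⟨by linarith, le_rfl⟩ t ht (by ring))
    · have cU := H.cont_U.mono hsub
      have cp := H.cont_p.mono hsub
      have ch := H.cont_h.mono hsub
      have cθ := Real.continuous_arctan.comp_continuousOn cp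
      have cc := Real.continuous_cos.comp_continuousOn cθ
      have cm : ContinuousOn (fun q : ℝ × ℝ =>
          1 / (9 / 10 - (Real.arctan (p q.1 q.2) - Real.pi / 4) ^ 2))
          (Icc (x0 - 1) (x0 + 1) ×ˢ Icc (-1) 0) :=
        continuousOn_const.div (continuousOn_const.sub ((cθ.sub continuousOn_const).pow 2))
          fun q hq => by
            have := sq_arctan_sub_le (hb q.1 hq.1 q.2 hq.2).1
            exact (sub_pos.2 (this.trans_lt (by norm_num))).ne'
      rw [hF]
      unfold localizedEnergy
      refine ContinuousOn.add (ContinuousOn.add (ContinuousOn.mul (by fun_prop)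
        (((ch.mul cc).pow 2).mul cm)) (continuousOn_const.mul (ContinuousOn.mul (by fun_prop)
        ((cθ.sub continuousOn_const).pow 2)))) (continuousOn_const.mul ((cU.sub (by fun_prop)).pow 2))
    · intro x hx t ht
      obtain ⟨hp0, hpC, hWA, hUx, haU, hUA⟩ := hb x ⟨hx.1.le, hx.2.le⟩ t ⟨ht.1.le, ht.2⟩
      rw [hF, hN]
      exact exists_jet_localizedEnergy_lt H hx0 hx ht ⟨by linarith [ht.1], by linarith [ht.2]⟩
        hε hε1 hp0 hpC hWA hUx haU hUA hS0 hR hg0 hRl hl2l hl1pos hl2pos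
  have hp := hb x0 hmem0 0 ⟨by norm_num, le_rfl⟩
  have hτ0 := sq_arctan_sub_le hp.1
  have hm1 : 1 ≤ 1 / (9 / 10 - (Real.arctan (p x0 0) - Real.pi / 4) ^ 2) := by
    rw [le_div_iff₀ (by linarith)]
    nlinarith [sq_nonneg (Real.arctan (p x0 0) - Real.pi / 4)]
  have hlow : (h x0 0 * Real.cos (Real.arctan (p x0 0))) ^ 2 ≤ F x0 0 := by
    have e1 := mul_le_mul_of_nonneg_left hm1
      (sq_nonneg (h x0 0 * Real.cos (Real.arctan (p x0 0))))
    have e2 : 0 ≤ l1 * (Real.arctan (p x0 0) - Real.arctan a) ^ 2 := by positivity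
    have e3 : 0 ≤ l2 * (U x0 0 - c) ^ 2 := by positivity
    simp only [hF, localizedEnergy]
    norm_num at e1 e2 e3 ⊢
    linarith
  rw [mul_pow, Real.cos_sq_arctan, mul_one_div, div_le_iff₀ (by positivity)] at hlow
  have hfin : h x0 0 ^ 2 ≤ (l2 * A ^ 2 + N) * (1 + C1 ^ 2) * ε ^ 2 := by
    calc h x0 0 ^ 2 ≤ F x0 0 * (1 + p x0 0 ^ 2) := hlow
      _ ≤ (l2 * A ^ 2 * ε ^ 2 + N * ε ^ 2) * (1 + p x0 0 ^ 2) := by gcongr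
      _ ≤ (l2 * A ^ 2 * ε ^ 2 + N * ε ^ 2) * (1 + C1 ^ 2) := by
        have := hp.1
        have := hp.2.1
        gcongr
      _ = _ := by ring
  rw [← Real.sqrt_sq_eq_abs]
  calc Real.sqrt (h x0 0 ^ 2) ≤ Real.sqrt ((l2 * A ^ 2 + N) * (1 + C1 ^ 2) * ε ^ 2) :=
        Real.sqrt_le_sqrt hfin
    _ = _ := by rw [Real.sqrt_mul (by positivity), Real.sqrt_sq hε.le]

/-- Partial derivatives of a smooth function of two variables, as derivatives along slices. -/
theorem ContDiffOn.hasDerivAt_slices {f : ℝ × ℝ → ℝ} {Ω : Set (ℝ × ℝ)} (hΩ : IsOpen Ω)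
    (hf : ContDiffOn ℝ (⊤ : ℕ∞) f Ω) {x t : ℝ} (h : (x, t) ∈ Ω) :
    HasDerivAt (fun y => f (y, t)) (fderiv ℝ f (x, t) (1, 0)) x ∧
      HasDerivAt (fun s => f (x, s)) (fderiv ℝ f (x, t) (0, 1)) t := by
  have hd : HasFDerivAt f (fderiv ℝ f (x, t)) (x, t) :=
    ((hf.differentiableOn (by simp)).differentiableAt (hΩ.mem_nhds h)).hasFDerivAt
  constructor
  · exact hd.comp_hasDerivAt (f := fun y : ℝ => (y, t)) x
      ((hasDerivAt_id x).prodMk (hasDerivAt_const x t))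
  · exact hd.comp_hasDerivAt (f := fun s : ℝ => (x, s)) t
      ((hasDerivAt_const t x).prodMk (hasDerivAt_id t))

theorem ContDiffOn.fderiv_apply_const {f : ℝ × ℝ → ℝ} {Ω : Set (ℝ × ℝ)} (hΩ : IsOpen Ω)
    (hf : ContDiffOn ℝ (⊤ : ℕ∞) f Ω) (v : ℝ × ℝ) :
    ContDiffOn ℝ (⊤ : ℕ∞) (fun q => fderiv ℝ f q v) Ω :=
  (hf.fderiv_of_isOpen hΩ (by simp)).clm_apply contDiffOn_const

theorem ContDiffOn.fderiv_fderiv_comm {f : ℝ × ℝ → ℝ} {Ω : Set (ℝ × ℝ)} (hΩ : IsOpen Ω)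
    (hf : ContDiffOn ℝ (⊤ : ℕ∞) f Ω) {q : ℝ × ℝ} (h : q ∈ Ω) (v w : ℝ × ℝ) :
    fderiv ℝ (fun q => fderiv ℝ f q v) q w = fderiv ℝ (fun q => fderiv ℝ f q w) q v := by
  have hq : ContDiffAt ℝ (⊤ : ℕ∞) f q := hf.contDiffAt (hΩ.mem_nhds h)
  have hs := hq.isSymmSndFDerivAt (by
    simp only [minSmoothness_of_isRCLikeNormedField]; exact WithTop.coe_le_coe.2 le_top)
  have hd : DifferentiableAt ℝ (fderiv ℝ f) q :=
    ((hf.fderiv_of_isOpen hΩ (m := (⊤ : ℕ∞)) (by simp)).differentiableOn (by simp)).differentiableAt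
      (hΩ.mem_nhds h)
  have e : ∀ v w, fderiv ℝ (fun q => fderiv ℝ f q v) q w = fderiv ℝ (fderiv ℝ f) q w v := by
    intro v w
    rw [fderiv_clm_apply hd (differentiableAt_const v)]
    simp
  rw [e, e, hs]

/-- A smooth positive solution of the profile equation, with its partial derivatives, is a
`ProfileFlow`. -/
theorem exists_profileFlow {u : ℝ → ℝ → ℝ} {t0 : ℝ}
    (hu : ContDiffOn ℝ (⊤ : ℕ∞) (fun q : ℝ × ℝ => u q.1 q.2) (Ioi 0 ×ˢ Ioo 0 t0))
    (hpos : ∀ x > 0, ∀ t ∈ Ioo 0 t0, 0 < u x t)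
    (heq : ∀ x > 0, ∀ t ∈ Ioo 0 t0, deriv (fun s => u x s) t
        = deriv (deriv (fun y => u y t)) x / (1 + (deriv (fun y => u y t) x) ^ 2)
          + (3 / x) * deriv (fun y => u y t) x - 3 / u x t) :
    ∃ p p1 h h1 h2, ProfileFlow u p p1 h h1 h2 0 t0 := by
  have hΩ : IsOpen ((Ioi (0 : ℝ)) ×ˢ Ioo 0 t0) := isOpen_Ioi.prod isOpen_Ioo
  have hp := hu.fderiv_apply_const hΩ (1, 0)
  have hh := hu.fderiv_apply_const hΩ (0, 1)
  have hp1 := hp.fderiv_apply_const hΩ (1, 0)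
  have hh1 := hh.fderiv_apply_const hΩ (1, 0)
  have hcomm := fun q hq => hu.fderiv_fderiv_comm hΩ (q := q) hq (1, 0) (0, 1)
  refine ⟨fun x t => _, fun x t => _, fun x t => _, fun x t => _, fun x t => _, hpos,
    fun x hx t ht => (hu.hasDerivAt_slices hΩ (x := x) (t := t) ⟨hx, ht⟩).1,
    fun x hx t ht => (hu.hasDerivAt_slices hΩ (x := x) (t := t) ⟨hx, ht⟩).2,
    fun x hx t ht => (hp.hasDerivAt_slices hΩ (x := x) (t := t) ⟨hx, ht⟩).1, ?_,
    fun x hx t ht => (hh.hasDerivAt_slices hΩ (x := x) (t := t) ⟨hx, ht⟩).1,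
    fun x hx t ht => (hh1.hasDerivAt_slices hΩ (x := x) (t := t) ⟨hx, ht⟩).1, ?_, ?_,
    hu.continuousOn, hp.continuousOn, hh.continuousOn⟩
  · intro x hx t ht
    have := (hp.hasDerivAt_slices hΩ (x := x) (t := t) ⟨hx, ht⟩).2
    rwa [hcomm (x, t) ⟨hx, ht⟩] at this
  · intro x hx t ht
    have := (hp1.hasDerivAt_slices hΩ (x := x) (t := t) ⟨hx, ht⟩).2
    have hxt : (x, t) ∈ Ioi (0 : ℝ) ×ˢ Ioo 0 t0 := ⟨hx, ht⟩
    have hev : (fun q => fderiv ℝ (fun q => fderiv ℝ (fun q : ℝ × ℝ => u q.1 q.2) q (1, 0)) q (0, 1))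
        =ᶠ[nhds (x, t)]
        fun q => fderiv ℝ (fun q => fderiv ℝ (fun q : ℝ × ℝ => u q.1 q.2) q (0, 1)) q (1, 0) := by
      filter_upwards [hΩ.mem_nhds hxt] with q hq using hcomm q hq
    rwa [hp.fderiv_fderiv_comm hΩ hxt (1, 0) (0, 1), hev.fderiv_eq] at this
  · intro x (hx : 0 < x) t ht
    have e1 : ∀ y > 0, deriv (fun y => u y t) y = _ := fun y hy =>
      (hu.hasDerivAt_slices hΩ (x := y) (t := t) ⟨hy, ht⟩).1.deriv
    have e2 := (hu.hasDerivAt_slices hΩ (x := x) (t := t) ⟨hx, ht⟩).2.deriv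
    have e3 := ((hp.hasDerivAt_slices hΩ (x := x) (t := t) ⟨hx, ht⟩).1.congr_of_eventuallyEq
      (show deriv (fun y => u y t) =ᶠ[nhds x] _ by
        filter_upwards [lt_mem_nhds hx] with y hy using e1 y hy)).deriv
    have := heq x hx t ht
    rw [e3, e1 x hx] at this
    exact e2.symm.trans this

/-- Parabolic rescaling of a solution of the profile equation. -/
theorem ProfileFlow.rescale {U p p1 h h1 h2 : ℝ → ℝ → ℝ} {α β r : ℝ}
    (H : ProfileFlow U p p1 h h1 h2 α β) (hr : 0 < r) (T : ℝ) :
    ProfileFlow (fun x t => U (r * x) (T + r ^ 2 * t) / r) (fun x t => p (r * x) (T + r ^ 2 * t))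
      (fun x t => p1 (r * x) (T + r ^ 2 * t) * r) (fun x t => h (r * x) (T + r ^ 2 * t) * r)
      (fun x t => h1 (r * x) (T + r ^ 2 * t) * r ^ 2)
      (fun x t => h2 (r * x) (T + r ^ 2 * t) * r ^ 3)
      ((α - T) / r ^ 2) ((β - T) / r ^ 2) := by
  have hx : ∀ x > 0, 0 < r * x := fun x hx => mul_pos hr hx
  have hr2 : 0 < r ^ 2 := by positivity
  have ht : ∀ t ∈ Ioo ((α - T) / r ^ 2) ((β - T) / r ^ 2), T + r ^ 2 * t ∈ Ioo α β := fun t ht =>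
    ⟨by have := (div_lt_iff₀ hr2).1 ht.1; linarith, by have := (lt_div_iff₀ hr2).1 ht.2; linarith⟩
  have sx : ∀ x, HasDerivAt (fun x => r * x) r x := fun x => by
    simpa using (hasDerivAt_id x).const_mul r
  have st : ∀ t, HasDerivAt (fun t => T + r ^ 2 * t) (r ^ 2) t := fun t => by
    simpa using ((hasDerivAt_id t).const_mul (r ^ 2)).const_add T
  have cs : ContinuousOn (fun q : ℝ × ℝ => (r * q.1, T + r ^ 2 * q.2))
      (Ioi 0 ×ˢ Ioo ((α - T) / r ^ 2) ((β - T) / r ^ 2)) := by fun_prop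
  have ms : MapsTo (fun q : ℝ × ℝ => (r * q.1, T + r ^ 2 * q.2))
      (Ioi 0 ×ˢ Ioo ((α - T) / r ^ 2) ((β - T) / r ^ 2)) (Ioi 0 ×ˢ Ioo α β) :=
    fun q hq => ⟨hx _ hq.1, ht _ hq.2⟩
  refine ⟨fun x hx' t ht' => div_pos (H.pos _ (hx x hx') _ (ht t ht')) hr,
    fun x hx' t ht' => ?_, fun x hx' t ht' => ?_, fun x hx' t ht' => ?_, fun x hx' t ht' => ?_,
    fun x hx' t ht' => ?_, fun x hx' t ht' => ?_, fun x hx' t ht' => ?_, fun x hx' t ht' => ?_,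
    ((H.cont_U.comp cs ms).div_const r), H.cont_p.comp cs ms,
    (H.cont_h.comp cs ms).mul continuousOn_const⟩
  · exact (((H.space_U _ (hx x hx') _ (ht t ht')).comp x (sx x)).div_const r).congr_deriv
      (by field_simp)
  · exact (((H.time_U _ (hx x hx') _ (ht t ht')).comp t (st t)).div_const r).congr_deriv
      (by field_simp)
  · exact (H.space_p _ (hx x hx') _ (ht t ht')).comp x (sx x)
  · exact (H.time_p _ (hx x hx') _ (ht t ht')).comp t (st t)
  · exact (((H.space_h _ (hx x hx') _ (ht t ht')).comp x (sx x)).mul_const r).congr_deriv (by ring)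
  · exact (((H.space_h1 _ (hx x hx') _ (ht t ht')).comp x (sx x)).mul_const (r ^ 2)).congr_deriv
      (by ring)
  · exact (((H.time_p1 _ (hx x hx') _ (ht t ht')).comp t (st t)).mul_const r).congr_deriv (by ring)
  · have hU := (H.pos _ (hx x hx') _ (ht t ht')).ne'
    have := hx'.ne'
    rw [H.eqn _ (hx x hx') _ (ht t ht')]
    field_simp

theorem abs_deriv_sub_le_of_abs_deriv_deriv_le {f : ℝ → ℝ} {C x y : ℝ}
    (hf : ContDiffOn ℝ (⊤ : ℕ∞) f (Ioi 0)) (hC : ∀ x > 0, |deriv (deriv f) x| ≤ C)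
    (hx : 0 < x) (hy : 0 < y) : |deriv f x - deriv f y| ≤ C * |x - y| :=
  (convex_Ioi 0).norm_image_sub_le_of_norm_deriv_le
    (fun z hz => ((hf.deriv_of_isOpen (m := (⊤ : ℕ∞)) isOpen_Ioi (by simp)).differentiableOn
      (by simp)).differentiableAt (Ioi_mem_nhds hz)) (fun z hz => hC z hz) hy hx

theorem abs_sub_affine_le_of_abs_deriv_deriv_le {f : ℝ → ℝ} {C x y : ℝ}
    (hf : ContDiffOn ℝ (⊤ : ℕ∞) f (Ioi 0)) (hC : ∀ x > 0, |deriv (deriv f) x| ≤ C)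
    (hx : 0 < x) (hy : 0 < y) : |f x - f y - deriv f y * (x - y)| ≤ C * |x - y| ^ 2 := by
  have hsub : uIcc y x ⊆ Ioi 0 := fun z hz => (lt_min hy hx).trans_le hz.1
  have hd : ∀ z ∈ uIcc y x, HasDerivAt (fun z => f z - f y - deriv f y * (z - y))
      (deriv f z - deriv f y) z := fun z hz => by
    have h1 : HasDerivAt f (deriv f z) z :=
      ((hf.differentiableOn (by simp)).differentiableAt (Ioi_mem_nhds (hsub hz))).hasDerivAt
    have h2 := ((hasDerivAt_id z).sub_const y).const_mul (deriv f y)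
    exact ((h1.sub_const (f y)).sub h2).congr_deriv (by simp)
  have hC0 : 0 ≤ C := (abs_nonneg _).trans (hC x hx)
  have := (convex_uIcc y x).norm_image_sub_le_of_norm_hasDerivWithin_le
    (C := C * |x - y|) (fun z hz => (hd z hz).hasDerivWithinAt) (fun z hz => ?_)
    left_mem_uIcc right_mem_uIcc
  · simpa [Real.norm_eq_abs, sq, mul_assoc] using this
  · refine (abs_deriv_sub_le_of_abs_deriv_deriv_le hf hC (hsub hz) hy).trans ?_
    exact mul_le_mul_of_nonneg_left (abs_sub_left_of_mem_uIcc hz) hC0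

theorem exists_abs_sub_self_le {f : ℝ → ℝ} {K : ℝ} {m : ℕ} (hm : 2 ≤ m) (hK : 0 ≤ K)
    (hf : (fun x => f x - x - K * x ^ m) =o[nhdsWithin 0 (Ioi 0)] fun x : ℝ => x ^ m) :
    ∃ δ > 0, ∀ x ∈ Ioo 0 δ, |f x - x| ≤ (K + 1) * x ^ 2 := by
  obtain ⟨δ, hδ, hs⟩ := mem_nhdsGT_iff_exists_Ioo_subset.1 (hf.bound one_pos)
  refine ⟨min δ 1, lt_min hδ one_pos, fun x hx => ?_⟩
  have h1 : ‖f x - x - K * x ^ m‖ ≤ 1 * ‖x ^ m‖ := hs ⟨hx.1, hx.2.trans_le (min_le_left _ _)⟩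
  have h2 : x ^ m ≤ x ^ 2 := pow_le_pow_of_le_one hx.1.le (hx.2.le.trans (min_le_right _ _)) hm
  have h3 : 0 ≤ x ^ m := pow_nonneg hx.1.le _
  rw [Real.norm_eq_abs, Real.norm_of_nonneg h3, abs_le] at h1
  have h4 := mul_le_mul_of_nonneg_left h2 hK
  have h5 := mul_nonneg hK h3
  rw [abs_le]
  constructor <;> linarith

theorem exists_abs_deriv_sub_one_le {f : ℝ → ℝ} {C B δ : ℝ}
    (hf : ContDiffOn ℝ (⊤ : ℕ∞) f (Ioi 0)) (hd1 : ∀ x > 0, 0 ≤ deriv f x ∧ deriv f x ≤ C)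
    (hd2 : ∀ x > 0, |deriv (deriv f) x| ≤ C) (hδ : 0 < δ)
    (hB : ∀ x ∈ Ioo 0 δ, |f x - x| ≤ B * x ^ 2) :
    ∃ A, ∀ x > 0, |deriv f x - 1| ≤ A * x := by
  have hC : 0 ≤ C := (hd1 1 one_pos).1.trans (hd1 1 one_pos).2
  refine ⟨max ((C + 5 * B) / 2) ((C + 1) / δ), fun x hx => ?_⟩
  rcases lt_or_ge x δ with h | h
  · have h1 := hB x ⟨hx, h⟩
    have h2 := hB (x / 2) ⟨half_pos hx, by linarith⟩
    have h3 := abs_sub_affine_le_of_abs_deriv_deriv_le hf hd2 (half_pos hx) hx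
    rw [sq_abs] at h3
    have h4 : |deriv f x - 1| ≤ (C + 5 * B) / 2 * x := by
      refine le_of_mul_le_mul_right (a := x / 2) ?_ (half_pos hx)
      rw [← abs_of_pos (half_pos hx), ← abs_mul, abs_of_pos (half_pos hx)]
      rw [abs_le] at *
      constructor <;> nlinarith
    exact h4.trans (mul_le_mul_of_nonneg_right (le_max_left _ _) hx.le)
  · have h1 := hd1 x hx
    have h2 : |deriv f x - 1| ≤ (C + 1) / δ * x := by
      have : (C + 1) / δ * δ ≤ (C + 1) / δ * x := mul_le_mul_of_nonneg_left h (by positivity)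
      rw [div_mul_cancel₀ _ hδ.ne'] at this
      rw [abs_le]
      constructor <;> linarith
    exact h2.trans (mul_le_mul_of_nonneg_right (le_max_right _ _) hx.le)

/-- In the outer region, `1/u` stays within bounded distance of `1/x`. -/
theorem exists_abs_inv_sub_inv_le {u : ℝ → ℝ → ℝ} {u0 : ℝ → ℝ} {M t0 B δ : ℝ} (hM : 1 < M)
    (hδ : 0 < δ) (hB0 : 0 ≤ B) (hB : ∀ x ∈ Ioo 0 δ, |u0 x - x| ≤ B * x ^ 2)
    (hpos : ∀ x > 0, ∀ t ∈ Ioc 0 t0, 0 < u x t)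
    (hcont : ∀ x > 0, ContinuousOn (u x) (Ioc 0 t0))
    (hmono : ∀ t ∈ Ioc 0 t0, MonotoneOn (fun x => u x t) (Ioi 0))
    (hclose : ∀ x > 0, ∀ t ∈ Ioc 0 t0, M / 2 * Real.sqrt t ≤ x → |u x t - u0 x| ≤ M * t) :
    ∃ A, 0 ≤ A ∧ ∀ x > 0, ∀ t ∈ Ioc 0 t0, M / 2 * Real.sqrt t ≤ x →
      |1 / u x t - 1 / x| ≤ A := by
  obtain ⟨δ1, hδ1, hδ1δ, hδ1B⟩ : ∃ δ1 > 0, δ1 < δ ∧ (B + 4) * δ1 ≤ 1 / 2 := by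
    refine ⟨min (δ / 2) (1 / (2 * (B + 4))), by positivity,
      (min_le_left _ _).trans_lt (by linarith), ?_⟩
    calc (B + 4) * min (δ / 2) (1 / (2 * (B + 4))) ≤ (B + 4) * (1 / (2 * (B + 4))) := by
          gcongr; exact min_le_right _ _
      _ = 1 / 2 := by field_simp
  have hnear : ∀ x > 0, x ≤ δ1 → ∀ t ∈ Ioc 0 t0, M / 2 * Real.sqrt t ≤ x →
      |u x t - x| ≤ (B + 4) * x ^ 2 ∧ x / 2 ≤ u x t := by
    intro x hx hxδ t ht hxt
    have h1 := hclose x hx t ht hxt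
    have h2 := hB x ⟨hx, hxδ.trans_lt hδ1δ⟩
    have h3 : M * t ≤ 4 * x ^ 2 := by
      have h4 := pow_le_pow_left₀ (by positivity) hxt 2
      rw [mul_pow, Real.sq_sqrt ht.1.le] at h4
      nlinarith [mul_pos (by linarith : 0 < M) ht.1]
    have h4 : |u x t - x| ≤ (B + 4) * x ^ 2 := by
      rw [abs_le] at *
      constructor <;> linarith
    have h5 : (B + 4) * x ≤ 1 / 2 := (mul_le_mul_of_nonneg_left hxδ (by linarith)).trans hδ1B
    have h6 := mul_le_mul_of_nonneg_right h5 hx.le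
    exact ⟨h4, by linarith [(abs_le.1 h4).1]⟩
  obtain ⟨c, hc, hcu⟩ : ∃ c > 0, ∀ t ∈ Ioc 0 t0, c ≤ u δ1 t := by
    have hT : 0 < 4 * δ1 ^ 2 / M ^ 2 := by positivity
    have hsub : Icc (4 * δ1 ^ 2 / M ^ 2) t0 ⊆ Ioc 0 t0 := fun t ht => ⟨hT.trans_le ht.1, ht.2⟩
    obtain ⟨c, hc, hcu⟩ : ∃ c > 0, ∀ t ∈ Icc (4 * δ1 ^ 2 / M ^ 2) t0, c ≤ u δ1 t :=
      isCompact_Icc.exists_forall_le' ((hcont δ1 hδ1).mono hsub)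
        fun t ht => hpos δ1 hδ1 t (hsub ht)
    refine ⟨min c (δ1 / 2), by positivity, fun t ht => ?_⟩
    rcases le_or_gt (M / 2 * Real.sqrt t) δ1 with h | h
    · exact (min_le_right _ _).trans (hnear δ1 hδ1 le_rfl t ht h).2
    · refine (min_le_left _ _).trans (hcu t ⟨?_, ht.2⟩)
      have h4 := pow_le_pow_left₀ hδ1.le h.le 2
      rw [mul_pow, Real.sq_sqrt ht.1.le] at h4
      rw [div_le_iff₀ (by positivity)]
      linarith
  refine ⟨max (2 * (B + 4)) (1 / c + 1 / δ1), by positivity, fun x hx t ht hxt => ?_⟩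
  have hu := hpos x hx t ht
  rcases le_or_gt x δ1 with h | h
  · refine le_trans ?_ (le_max_left _ _)
    obtain ⟨h1, h2⟩ := hnear x hx h t ht hxt
    have e : 1 / u x t - 1 / x = -(u x t - x) / (u x t * x) := by field_simp; ring
    rw [e, abs_div, abs_neg, abs_of_pos (mul_pos hu hx), div_le_iff₀ (mul_pos hu hx)]
    refine h1.trans ?_
    have := mul_le_mul_of_nonneg_left (mul_le_mul_of_nonneg_right h2 hx.le)
      (by linarith : 0 ≤ 2 * (B + 4))
    linarith
  · refine le_trans ?_ (le_max_right _ _)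
    have h1 : c ≤ u x t := (hcu t ht).trans (hmono t ht hδ1 hx h.le)
    have h2 : 1 / u x t ≤ 1 / c := one_div_le_one_div_of_le hc h1
    have h3 : 1 / x ≤ 1 / δ1 := one_div_le_one_div_of_le hδ1 h.le
    have h4 : 0 < 1 / u x t := by positivity
    have h5 : 0 < 1 / x := by positivity
    rw [abs_le]
    constructor <;> linarith

/-- Applying the interior estimate at scale `√t / 2` bounds the speed in the outer region at interior
times. -/
theorem ProfileFlow.exists_abs_speed_le {u p p1 h h1 h2 : ℝ → ℝ → ℝ} {u0 u0' : ℝ → ℝ}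
    {M t0 C0 C1 A2 A3 : ℝ} (H : ProfileFlow u p p1 h h1 h2 0 t0) (hM : 1 < M)
    (ht0 : t0 ≤ 1) (hC0 : 0 ≤ C0) (hC1 : 0 ≤ C1) (hA2 : 0 ≤ A2)
    (hp : ∀ x > 0, ∀ t ∈ Ioo 0 t0, 0 ≤ p x t ∧ p x t ≤ C1)
    (hu0 : ∀ x > 0, ∀ y > 0, |u0 x - u0 y - u0' y * (x - y)| ≤ C0 * |x - y| ^ 2)
    (hu0' : ∀ x > 0, |u0' x - 1| ≤ A3 * x)
    (hclose : ∀ x > 0, ∀ t ∈ Ioo 0 t0, M / 2 * Real.sqrt t ≤ x → |u x t - u0 x| ≤ M * t)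
    (hinv : ∀ x > 0, ∀ t ∈ Ioo 0 t0, M / 2 * Real.sqrt t ≤ x → |1 / u x t - 1 / x| ≤ A2) :
    ∃ C, ∀ x, ∀ t ∈ Ioo 0 t0, M * Real.sqrt t ≤ x → |h x t| ≤ C := by
  have hA3 : 0 ≤ A3 := by simpa using (abs_nonneg _).trans (hu0' 1 one_pos)
  obtain ⟨A, hA⟩ : ∃ A, A = 4 * M + C0 + A2 + 2 * A3 + 1 := ⟨_, rfl⟩
  obtain ⟨C, hC⟩ := interior_speed_estimate A C1 hC1
  refine ⟨C, fun X T hT hX => ?_⟩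
  obtain ⟨r, hr⟩ : ∃ r, r = Real.sqrt T / 2 := ⟨_, rfl⟩
  have hT0 := hT.1
  have hsq : 0 < Real.sqrt T := Real.sqrt_pos.2 hT0
  have hr0 : 0 < r := by rw [hr]; positivity
  have hr2 : r ^ 2 = T / 4 := by rw [hr, div_pow, Real.sq_sqrt hT0.le]; norm_num
  have hr1 : r ≤ 1 := by
    have := Real.sqrt_le_one.2 (hT.2.le.trans ht0)
    linarith
  have hMr : 2 * M * r ≤ X := by rw [hr]; linarith
  have hXr : 2 * r ≤ X := by nlinarith
  have hX0 : 0 < X := by linarith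
  have key := hC _ _ _ _ _ _ _ _ (X / r) (u0' X) (u0 X / r) r (H.rescale hr0 T)
    (by rw [div_lt_iff₀ (by positivity)]; linarith)
    (div_pos (by linarith [hT.2]) (by positivity)) (by rwa [le_div_iff₀ hr0]) hr0 hr1 ?_
  · rw [mul_div_cancel₀ _ hr0.ne', mul_zero, add_zero, abs_mul, abs_of_pos hr0] at key
    exact le_of_mul_le_mul_right key hr0
  intro y hy s hs
  obtain ⟨x, hx⟩ : ∃ x, x = r * y := ⟨_, rfl⟩
  obtain ⟨t, ht⟩ : ∃ t, t = T + r ^ 2 * s := ⟨_, rfl⟩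
  have hyx : y = x / r := by rw [hx]; field_simp
  rw [← hx, ← ht]
  have hxX : |x - X| ≤ r := by
    have h1 : x - X = r * (y - X / r) := by rw [hx]; field_simp
    rw [h1, abs_mul, abs_of_pos hr0]
    have h2 : |y - X / r| ≤ 1 := abs_le.2 ⟨by linarith [hy.1], by linarith [hy.2]⟩
    exact mul_le_of_le_one_right hr0.le h2
  obtain ⟨hx1, hx2⟩ := abs_le.1 hxX
  have hxr : r ≤ x := by linarith
  have hx0 : 0 < x := by linarith
  have htT : t ≤ T := by rw [ht]; nlinarith [hs.2, sq_nonneg r]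
  have ht0 : 0 < t := by rw [ht, hr2]; nlinarith [hs.1]
  have htI : t ∈ Ioo 0 t0 := ⟨ht0, htT.trans_lt hT.2⟩
  have hxt : M / 2 * Real.sqrt t ≤ x := by
    have h1 : Real.sqrt t ≤ 2 * r := by rw [hr]; linarith [Real.sqrt_le_sqrt htT]
    have h2 := mul_le_mul_of_nonneg_left h1 (by linarith : 0 ≤ M / 2)
    nlinarith
  have hu := H.pos x hx0 t htI
  have hc := hclose x hx0 t htI hxt
  have hi := hinv x hx0 t htI hxt
  have htay := hu0 x hx0 X hX0
  have hA2A : A2 * r ≤ A * r := by gcongr; linarith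
  obtain ⟨hpx0, hpx1⟩ := hp x hx0 t htI
  refine ⟨hpx0, hpx1, ?_, ?_, ?_, ?_⟩
  · have e : u x t / r - (u0 X / r + u0' X * (y - X / r)) =
        (u x t - u0 X - u0' X * (x - X)) / r := by rw [hyx]; field_simp; ring
    rw [e, abs_div, abs_of_pos hr0, div_le_iff₀ hr0]
    have h1 : C0 * |x - X| ^ 2 ≤ C0 * r ^ 2 := by gcongr
    have h2 : M * t ≤ M * (4 * r ^ 2) := by gcongr; linarith
    have h3 : (4 * M + C0) * r ^ 2 ≤ A * r ^ 2 := by gcongr; linarith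
    have h4 : |u x t - u0 X - u0' X * (x - X)| ≤
        |u x t - u0 x| + |u0 x - u0 X - u0' X * (x - X)| := by
      have := abs_add_le (u x t - u0 x) (u0 x - u0 X - u0' X * (x - X))
      rwa [show u x t - u0 x + (u0 x - u0 X - u0' X * (x - X)) =
        u x t - u0 X - u0' X * (x - X) by ring] at this
    linarith
  · have e : 1 / (u x t / r) - 1 / y = r * (1 / u x t - 1 / x) := by rw [hyx]; field_simp
    rw [e, abs_mul, abs_of_pos hr0]
    linarith [mul_le_mul_of_nonneg_left hi hr0.le]
  · have e : u0' X / y - 1 / (u x t / r) = r * ((u0' X - 1) / x - (1 / u x t - 1 / x)) := by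
      rw [hyx]; field_simp; ring
    have h1 : |(u0' X - 1) / x| ≤ 2 * A3 := by
      rw [abs_div, abs_of_pos hx0, div_le_iff₀ hx0]
      have := mul_le_mul_of_nonneg_left (by linarith : X ≤ 2 * x) hA3
      linarith [hu0' X hX0]
    have h2 : |(u0' X - 1) / x - (1 / u x t - 1 / x)| ≤ A :=
      (abs_sub _ _).trans (by linarith)
    rw [e, abs_mul, abs_of_pos hr0, mul_comm]
    gcongr
  · have e : 1 / (u x t / r) = r / x + r * (1 / u x t - 1 / x) := by field_simp; ring
    have h1 : r / x ≤ 1 := by rwa [div_le_one hx0]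
    have h2 : r * (1 / u x t - 1 / x) ≤ 1 * A2 :=
      (mul_le_mul_of_nonneg_left (le_abs_self _) hr0.le).trans
        (mul_le_mul hr1 hi (abs_nonneg _) zero_le_one)
    linarith

/-- A derivative bound on an open interval passes to the right endpoint. -/
theorem abs_deriv_le_of_Ioo {f : ℝ → ℝ} {a b C : ℝ} (hab : a < b) (hC : 0 ≤ C)
    (hf : ContinuousOn f (Icc a b)) (hd : ∀ t ∈ Ioo a b, DifferentiableAt ℝ f t)
    (hb : ∀ t ∈ Ioo a b, |deriv f t| ≤ C) : |deriv f b| ≤ C := by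
  by_cases h : DifferentiableAt ℝ f b
  · have h1 := ((hasDerivAt_iff_tendsto_slope.1 h.hasDerivAt).mono_left
      (nhdsWithin_mono b (fun s (hs : s ∈ Iio b) => ne_of_lt hs))).abs
    refine le_of_tendsto h1 ?_
    filter_upwards [Ioo_mem_nhdsLT hab] with s hs
    obtain ⟨c, hc, hcs⟩ := exists_deriv_eq_slope f hs.2 (hf.mono (Icc_subset_Icc_left hs.1.le))
      fun t ht => (hd t ⟨hs.1.trans ht.1, ht.2⟩).differentiableWithinAt
    rw [slope_comm, slope_def_field, ← hcs]
    exact hb c ⟨hs.1.trans hc.1, hc.2⟩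
  · rw [deriv_zero_of_not_differentiableAt h, abs_zero]
    exact hC

/-- Uniform bound on `u_t`, and hence on the mean curvature `H = u_t/√(1+u_x²)`,
in the outer region `x ≥ M √t`, `0 < t ≤ t0`. -/
theorem stmt_14
    (k : ℕ) (hk : 4 ≤ k) (K0 C0 : ℝ) (hK0 : 0 < K0) (hC0 : 0 < C0)
    (u0 : ℝ → ℝ)
    (hu0smooth : ContDiffOn ℝ (⊤ : ℕ∞) u0 (Set.Ioi 0))
    (hu0pos : ∀ x > (0:ℝ), 0 < u0 x)
    (hu0asym : (fun x => u0 x - x - K0 * x ^ (2 * (k - 1)))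
        =o[nhdsWithin 0 (Set.Ioi 0)] fun x : ℝ => x ^ (2 * (k - 1)))
    (hd1 : ∀ x > (0:ℝ), 0 ≤ deriv u0 x ∧ deriv u0 x ≤ C0)
    (hd2 : ∀ x > (0:ℝ), |deriv (deriv u0) x| ≤ C0)
    (hd2' : ∀ x > (0:ℝ), |deriv (deriv u0) x| ≤ C0 * x ^ (2 * k - 4))
    (M t0 C1 : ℝ) (hM : 1 < M) (ht0 : 0 < t0) (ht0' : t0 < 1 / M ^ 2) (hC1 : 0 < C1)
    (u : ℝ → ℝ → ℝ)
    (husmooth : ContDiffOn ℝ (⊤ : ℕ∞) (fun q : ℝ × ℝ => u q.1 q.2)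
      (Set.Ioi (0:ℝ) ×ˢ Set.Ioc (0:ℝ) t0))
    (hupos : ∀ x > (0:ℝ), ∀ t ∈ Set.Ioc (0:ℝ) t0, 0 < u x t)
    (heq : ∀ x > (0:ℝ), ∀ t ∈ Set.Ioc (0:ℝ) t0,
      deriv (fun s => u x s) t
        = deriv (deriv (fun y => u y t)) x / (1 + (deriv (fun y => u y t) x) ^ 2)
          + (3 / x) * deriv (fun y => u y t) x - 3 / u x t)
    (hux : ∀ x > (0:ℝ), ∀ t ∈ Set.Ioc (0:ℝ) t0,
      0 ≤ deriv (fun y => u y t) x ∧ deriv (fun y => u y t) x ≤ C1)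
    (hclose : ∀ x > (0:ℝ), ∀ t ∈ Set.Ioc (0:ℝ) t0, (M / 2) * Real.sqrt t ≤ x →
      |u x t - u0 x| ≤ M * t * min 1 (x ^ (2 * k - 4))) :
    ∃ C : ℝ, ∀ x : ℝ, ∀ t ∈ Set.Ioc (0:ℝ) t0, M * Real.sqrt t ≤ x →
      |deriv (fun s => u x s) t| ≤ C ∧
      |deriv (fun s => u x s) t|
        / Real.sqrt (1 + (deriv (fun y => u y t) x) ^ 2) ≤ C := by
  have hIoo : Ioo 0 t0 ⊆ Ioc 0 t0 := Ioo_subset_Ioc_self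
  obtain ⟨p, p1, h, h1, h2, H⟩ := exists_profileFlow
    (husmooth.mono (prod_mono_right hIoo)) (fun x hx t ht => hupos x hx t (hIoo ht))
    (fun x hx t ht => heq x hx t (hIoo ht))
  have hclose' : ∀ x > 0, ∀ t ∈ Ioc 0 t0, M / 2 * Real.sqrt t ≤ x → |u x t - u0 x| ≤ M * t :=
    fun x hx t ht hxt => (hclose x hx t ht hxt).trans
      (mul_le_of_le_one_right (mul_nonneg (by linarith) ht.1.le) (min_le_left _ _))
  have hcont : ∀ x > 0, ContinuousOn (u x) (Ioc 0 t0) := fun x hx =>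
    husmooth.continuousOn.comp (f := fun t => (x, t)) (by fun_prop) fun t ht => ⟨hx, ht⟩
  have hdiff : ∀ t ∈ Ioc 0 t0, DifferentiableOn ℝ (fun x => u x t) (Ioi 0) := fun t ht =>
    (husmooth.differentiableOn (by simp)).comp (f := fun x => (x, t)) (by fun_prop)
      fun x hx => ⟨hx, ht⟩
  have hmono : ∀ t ∈ Ioc 0 t0, MonotoneOn (fun x => u x t) (Ioi 0) := fun t ht =>
    monotoneOn_of_deriv_nonneg (convex_Ioi 0) (hdiff t ht).continuousOn
      (by rw [interior_Ioi]; exact hdiff t ht)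
      (by rw [interior_Ioi]; exact fun x hx => (hux x hx t ht).1)
  obtain ⟨δ, hδ, hB⟩ := exists_abs_sub_self_le (by omega) hK0.le hu0asym
  obtain ⟨A2, hA2, hinv⟩ :=
    exists_abs_inv_sub_inv_le hM hδ (by positivity) hB hupos hcont hmono hclose'
  obtain ⟨A3, hA3⟩ := exists_abs_deriv_sub_one_le hu0smooth hd1 hd2 hδ hB
  have ht1 : t0 ≤ 1 := ht0'.le.trans (by
    rw [div_le_one (by positivity)]; exact one_le_pow₀ hM.le)
  obtain ⟨C, hC⟩ := H.exists_abs_speed_le hM ht1 hC0.le hC1.le hA2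
    (fun x hx t ht => by
      rw [← (H.space_U x hx t ht).deriv]; exact hux x hx t (hIoo ht))
    (fun x hx y hy => abs_sub_affine_le_of_abs_deriv_deriv_le hu0smooth hd2 hx hy) hA3
    (fun x hx t ht => hclose' x hx t (hIoo ht)) (fun x hx t ht => hinv x hx t (hIoo ht))
  have hfin : ∀ x, ∀ t ∈ Ioc 0 t0, M * Real.sqrt t ≤ x → |deriv (fun s => u x s) t| ≤ |C| := by
    intro x t ht hxt
    have hx : 0 < x := lt_of_lt_of_le (mul_pos (by linarith) (Real.sqrt_pos.2 ht.1)) hxt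
    have hlt : ∀ s ∈ Ioo 0 t, |deriv (fun s => u x s) s| ≤ |C| := fun s hs => by
      have hs0 : s ∈ Ioo 0 t0 := ⟨hs.1, hs.2.trans_le ht.2⟩
      rw [(H.time_U x hx s hs0).deriv]
      refine (hC x s hs0 (le_trans ?_ hxt)).trans (le_abs_self C)
      have := Real.sqrt_le_sqrt hs.2.le
      gcongr
    have hh : t / 2 < t := half_lt_self ht.1
    have hsub : ∀ s ∈ Ioo (t / 2) t, s ∈ Ioo 0 t := fun s hs => ⟨by linarith [hs.1, ht.1], hs.2⟩
    refine abs_deriv_le_of_Ioo hh (abs_nonneg C)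
      ((hcont x hx).mono fun s hs => ⟨by linarith [hs.1, ht.1], hs.2.trans ht.2⟩)
      (fun s hs => ?_) fun s hs => hlt s (hsub s hs)
    exact (H.time_U x hx s ⟨(hsub s hs).1, hs.2.trans_le ht.2⟩).differentiableAt
  refine ⟨|C|, fun x t ht hxt => ⟨hfin x t ht hxt, ?_⟩⟩
  refine (div_le_self (abs_nonneg _) ?_).trans (hfin x t ht hxt)
  rw [Real.one_le_sqrt]
  exact le_add_of_nonneg_right (sq_nonneg _)
end

section
/- Let W : [0,∞) → (0,∞) be a smooth solution of the Alencar equation on (0,∞) with W(0) = 1 and W'(0) = 0, and assume W(z)/z → 1 and W'(z) → 1 as z → ∞. Then: (i) W''(z) > 0 for all z > 0; (ii) 0 ≤ W(z) − z·W'(z) ≤ 1 for all z ≥ 0; and (iii) there exist constants Γ₂, Γ₃ ∈ ℝ and C > 0 such that |W(z) − z − Γ₂·z^{−2} − Γ₃·z^{−3}| ≤ C·z^{−5} for all z ≥ 1. -/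
open Filter Set

/-- If `f` vanishes at `z` and is positive just to the left of `z`, its derivative is nonpositive. -/
lemma HasDerivAt.nonpos_of_pos_left {f : ℝ → ℝ} {f' a z : ℝ} (haz : a < z)
    (hf : HasDerivAt f f' z) (hz : f z = 0) (hpos : ∀ x ∈ Ioo a z, 0 < f x) : f' ≤ 0 := by
  have h := (hasDerivAt_iff_tendsto_slope.1 hf).mono_left
    (nhdsWithin_mono z fun x (hx : x ∈ Iio z) => ne_of_lt hx)
  refine le_of_tendsto h ?_
  filter_upwards [Ioo_mem_nhdsLT haz] with x hx
  rw [slope_def_field, hz]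
  exact div_nonpos_of_nonneg_of_nonpos (by linarith [hpos x hx]) (by linarith [hx.2])

/-- A continuous function on `(0, ∞)` that is positive near `0` and has no first zero is positive. -/
lemma pos_of_no_first_zero {m : ℝ → ℝ} (hm : ContinuousOn m (Ioi 0))
    (h0 : ∀ᶠ z in nhdsWithin 0 (Ioi 0), 0 < m z)
    (hne : ∀ z > 0, (∀ x ∈ Ioo 0 z, 0 < m x) → m z ≠ 0) : ∀ z > 0, 0 < m z := by
  intro z₁ hz₁
  by_contra! hneg
  obtain ⟨ε, hε, hε'⟩ := mem_nhdsGT_iff_exists_Ioo_subset.1 h0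
  have hε0 : (0 : ℝ) < ε := hε
  have hεz : ε ≤ z₁ := by
    by_contra! h
    exact absurd (hε' ⟨hz₁, h⟩) (not_lt.2 hneg)
  have hcont : ContinuousOn m (Icc ε z₁) := hm.mono fun x hx => lt_of_lt_of_le hε0 hx.1
  have hcomp : IsCompact (Icc ε z₁ ∩ m ⁻¹' Iic 0) :=
    isCompact_Icc.of_isClosed_subset (hcont.preimage_isClosed_of_isClosed isClosed_Icc isClosed_Iic)
      inter_subset_left
  obtain ⟨z₀, ⟨hz₀, hm₀⟩, hleast⟩ := hcomp.exists_isLeast ⟨z₁, ⟨hεz, le_rfl⟩, hneg⟩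
  have hz₀pos : 0 < z₀ := lt_of_lt_of_le hε0 hz₀.1
  have hpos : ∀ x ∈ Ioo 0 z₀, 0 < m x := by
    intro x hx
    by_contra! h
    rcases lt_or_ge x ε with hxε | hxε
    · exact absurd (hε' ⟨hx.1, hxε⟩) (not_lt.2 h)
    · exact absurd (hleast ⟨⟨hxε, hx.2.le.trans hz₀.2⟩, h⟩) (not_le.2 hx.2)
  refine hne z₀ hz₀pos hpos (le_antisymm hm₀ ?_)
  have ht : Tendsto m (nhdsWithin z₀ (Iio z₀)) (nhds (m z₀)) :=
    ((hm.continuousAt (Ioi_mem_nhds hz₀pos)).tendsto).mono_left nhdsWithin_le_nhds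
  refine ge_of_tendsto ht ?_
  filter_upwards [Ioo_mem_nhdsLT hz₀pos] with x hx using (hpos x hx).le

/-- A function on `[1, ∞)` with derivative `O(z ^ (-(k+1)))` has a limit, at rate `z ^ (-k)`. -/
lemma exists_abs_sub_le_of_deriv_bound {f f' : ℝ → ℝ} {c : ℝ} (k : ℕ) (hc : 0 ≤ c)
    (hf : ∀ z ≥ 1, HasDerivAt f (f' z) z)
    (hf' : ∀ z ≥ 1, |f' z| ≤ c * (k * (z ^ (k + 1))⁻¹)) :
    ∃ L, ∀ z ≥ 1, |f z - L| ≤ c * (z ^ k)⁻¹ := by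
  have hd : ∀ z ≥ (1 : ℝ), HasDerivAt (fun x : ℝ => c * (x ^ k)⁻¹)
      (-(c * (k * (z ^ (k + 1))⁻¹))) z := by
    intro z hz
    have hz0 : z ≠ 0 := by positivity
    refine (((hasDerivAt_pow k z).inv (pow_ne_zero k hz0)).const_mul c).congr_deriv ?_
    rcases k with _ | k
    · simp
    · field_simp
      simp
      ring
  have hmono : MonotoneOn (fun x => f x - c * (x ^ k)⁻¹) (Ici 1) := by
    refine monotoneOn_of_hasDerivWithinAt_nonneg (convex_Ici 1)
      (fun x hx => ((hf x hx).sub (hd x hx)).continuousAt.continuousWithinAt)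
      (fun x hx => ((hf x (interior_subset hx)).sub (hd x (interior_subset hx))).hasDerivWithinAt) ?_
    intro x hx
    linarith [neg_abs_le (f' x), hf' x (interior_subset hx)]
  have hanti : AntitoneOn (fun x => f x + c * (x ^ k)⁻¹) (Ici 1) := by
    refine antitoneOn_of_hasDerivWithinAt_nonpos (convex_Ici 1)
      (fun x hx => ((hf x hx).add (hd x hx)).continuousAt.continuousWithinAt)
      (fun x hx => ((hf x (interior_subset hx)).add (hd x (interior_subset hx))).hasDerivWithinAt) ?_
    intro x hx
    linarith [le_abs_self (f' x), hf' x (interior_subset hx)]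
  have hle : ∀ x ≥ (1 : ℝ), ∀ z ≥ (1 : ℝ), f x - c * (x ^ k)⁻¹ ≤ f z + c * (z ^ k)⁻¹ := by
    intro x hx z hz
    have hM : (1 : ℝ) ≤ max x z := hx.trans (le_max_left x z)
    have h1 := hmono hx hM (le_max_left x z)
    have h2 := hanti hz hM (le_max_right x z)
    have h3 : 0 ≤ c * ((max x z) ^ k)⁻¹ := by positivity
    simp only at h1 h2
    linarith
  refine ⟨sSup ((fun x => f x - c * (x ^ k)⁻¹) '' Ici 1), fun z hz => ?_⟩
  have hlow : f z - c * (z ^ k)⁻¹ ≤ sSup ((fun x => f x - c * (x ^ k)⁻¹) '' Ici 1) :=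
    le_csSup ⟨f 1 + c * (1 ^ k)⁻¹, by rintro _ ⟨x, hx, rfl⟩; exact hle x hx 1 le_rfl⟩
      ⟨z, hz, rfl⟩
  have hup : sSup ((fun x => f x - c * (x ^ k)⁻¹) '' Ici 1) ≤ f z + c * (z ^ k)⁻¹ :=
    csSup_le ⟨_, 1, self_mem_Ici, rfl⟩ (by rintro _ ⟨x, hx, rfl⟩; exact hle x hx z hz)
  rw [abs_le]
  constructor <;> linarith

/-- A solution `W` of the Alencar equation starting from `(1, 0)`, with its first two derivatives
`p` and `q`, continuous up to `0`. -/
structure AlencarSolution (W p q : ℝ → ℝ) : Prop where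
  pos : ∀ z > 0, 0 < W z
  hasDerivAt : ∀ z > 0, HasDerivAt W (p z) z
  hasDerivAt' : ∀ z > 0, HasDerivAt p (q z) z
  eqn : ∀ z > 0, q z = 3 * (1 + p z ^ 2) * (z - W z * p z) / (z * W z)
  W_zero : W 0 = 1
  p_zero : p 0 = 0
  continuousOn : ContinuousOn W (Ici 0)
  continuousOn' : ContinuousOn p (Ici 0)
  continuousOn'' : ContinuousOn q (Ici 0)
  hasDerivWithinAt_zero : HasDerivWithinAt p (q 0) (Ici 0) 0

namespace AlencarSolution

variable {W p q : ℝ → ℝ}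

lemma tendsto_W_zero (h : AlencarSolution W p q) :
    Tendsto W (nhdsWithin 0 (Ioi 0)) (nhds 1) := by
  have := (h.continuousOn 0 self_mem_Ici).mono_left (nhdsWithin_mono 0 Ioi_subset_Ici_self)
  rwa [h.W_zero] at this

lemma tendsto_p_zero (h : AlencarSolution W p q) :
    Tendsto p (nhdsWithin 0 (Ioi 0)) (nhds 0) := by
  have := (h.continuousOn' 0 self_mem_Ici).mono_left (nhdsWithin_mono 0 Ioi_subset_Ici_self)
  rwa [h.p_zero] at this

lemma tendsto_p_div (h : AlencarSolution W p q) :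
    Tendsto (fun z => p z / z) (nhdsWithin 0 (Ioi 0)) (nhds (3 / 4)) := by
  have h1 : Tendsto (fun z => p z / z) (nhdsWithin 0 (Ioi 0)) (nhds (q 0)) := by
    have := (hasDerivWithinAt_iff_tendsto_slope.1 h.hasDerivWithinAt_zero).mono_left
      (nhdsWithin_mono 0 fun x (hx : 0 < x) => ⟨hx.le, hx.ne'⟩)
    refine this.congr fun z => ?_
    simp [slope_def_field, h.p_zero]
  have h2 : Tendsto q (nhdsWithin 0 (Ioi 0)) (nhds (q 0)) :=
    (h.continuousOn'' 0 self_mem_Ici).mono_left (nhdsWithin_mono 0 Ioi_subset_Ici_self)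
  have h3 : Tendsto (fun z => 3 * (1 + p z ^ 2) * (1 / W z - p z / z)) (nhdsWithin 0 (Ioi 0))
      (nhds (3 * (1 + 0 ^ 2) * (1 / 1 - q 0))) :=
    (((h.tendsto_p_zero.pow 2).const_add 1).const_mul 3).mul
      ((tendsto_const_nhds.div h.tendsto_W_zero one_ne_zero).sub h1)
  have h4 : q 0 = 3 * (1 + 0 ^ 2) * (1 / 1 - q 0) := by
    refine tendsto_nhds_unique (h2.congr' ?_) h3
    filter_upwards [self_mem_nhdsWithin] with z hz
    have hz0 : z ≠ 0 := ne_of_gt hz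
    have hW := (h.pos z hz).ne'
    rw [h.eqn z hz]
    field_simp
  have h5 : q 0 = 3 / 4 := by linarith
  rwa [h5] at h1

lemma eventually_barriers (h : AlencarSolution W p q) :
    ∀ᶠ z in nhdsWithin 0 (Ioi 0), 0 < min (z - W z * p z) (W z ^ 2 * p z - z ^ 2) := by
  have hid : Tendsto (fun z : ℝ => z) (nhdsWithin 0 (Ioi 0)) (nhds 0) := nhdsWithin_le_nhds
  have h1 : Tendsto (fun z => 1 - W z * (p z / z)) (nhdsWithin 0 (Ioi 0))
      (nhds (1 - 1 * (3 / 4))) := (h.tendsto_W_zero.mul h.tendsto_p_div).const_sub 1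
  have h2 : Tendsto (fun z => W z ^ 2 * (p z / z) - z) (nhdsWithin 0 (Ioi 0))
      (nhds (1 ^ 2 * (3 / 4) - 0)) := ((h.tendsto_W_zero.pow 2).mul h.tendsto_p_div).sub hid
  filter_upwards [h1.eventually_const_lt (by norm_num : (0 : ℝ) < _),
    h2.eventually_const_lt (by norm_num : (0 : ℝ) < _), self_mem_nhdsWithin] with z h1 h2 hz
  have hz0 : (0 : ℝ) < z := hz
  refine lt_min ?_ ?_
  · have := mul_pos hz0 h1
    field_simp at this
    linarith
  · have := mul_pos hz0 h2
    field_simp at this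
    linarith

lemma hasDerivAt_upper (h : AlencarSolution W p q) {z : ℝ} (hz : 0 < z) :
    HasDerivAt (fun z => z - W z * p z) (1 - (p z * p z + W z * q z)) z :=
  (hasDerivAt_id z).sub ((h.hasDerivAt z hz).mul (h.hasDerivAt' z hz))

lemma hasDerivAt_lower (h : AlencarSolution W p q) {z : ℝ} (hz : 0 < z) :
    HasDerivAt (fun z => W z ^ 2 * p z - z ^ 2)
      (2 * W z * p z ^ 2 + W z ^ 2 * q z - 2 * z) z := by
  refine ((((h.hasDerivAt z hz).pow 2).mul (h.hasDerivAt' z hz)).sub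
    (hasDerivAt_pow 2 z)).congr_deriv ?_
  simp
  ring

lemma lt_of_lower_barrier (h : AlencarSolution W p q) {z : ℝ} (hz : 0 < z)
    (hlow : ∀ x ∈ Ioo 0 z, 0 < W x ^ 2 * p x - x ^ 2) : z < W z := by
  have hmono : MonotoneOn (fun x => W x ^ 3 - x ^ 3) (Icc 0 z) := by
    refine monotoneOn_of_hasDerivWithinAt_nonneg (f' := fun x => 3 * (W x ^ 2 * p x - x ^ 2))
      (convex_Icc 0 z) ?_ ?_ ?_
    · exact ((h.continuousOn.pow 3).sub (continuous_pow 3).continuousOn).mono Icc_subset_Ici_self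
    · intro x hx
      rw [interior_Icc] at hx
      refine ((((h.hasDerivAt x hx.1).pow 3).sub
        (hasDerivAt_pow 3 x)).congr_deriv ?_).hasDerivWithinAt
      simp
      ring
    · intro x hx
      rw [interior_Icc] at hx
      linarith [hlow x hx]
  have h1 := hmono (left_mem_Icc.2 hz.le) (right_mem_Icc.2 hz.le) hz.le
  simp only [h.W_zero] at h1
  exact lt_of_pow_lt_pow_left₀ 3 (h.pos z hz).le (by linarith)

/-- The solution satisfies `(z / W) ^ 2 < W' < z / W`. -/
lemma barriers (h : AlencarSolution W p q) :
    ∀ z > 0, 0 < min (z - W z * p z) (W z ^ 2 * p z - z ^ 2) := by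
  refine pos_of_no_first_zero (ContinuousOn.inf
    (fun z hz => (h.hasDerivAt_upper hz).continuousAt.continuousWithinAt)
    (fun z hz => (h.hasDerivAt_lower hz).continuousAt.continuousWithinAt)) h.eventually_barriers ?_
  intro z hz hpos hzero
  have hup : ∀ x ∈ Ioo 0 z, 0 < x - W x * p x := fun x hx => (lt_min_iff.1 (hpos x hx)).1
  have hlow : ∀ x ∈ Ioo 0 z, 0 < W x ^ 2 * p x - x ^ 2 := fun x hx => (lt_min_iff.1 (hpos x hx)).2
  have hWz := h.lt_of_lower_barrier hz hlow
  have hW := h.pos z hz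
  have hq := h.eqn z hz
  rcases min_choice (z - W z * p z) (W z ^ 2 * p z - z ^ 2) with hm | hm
  · rw [hm] at hzero
    have hd := (h.hasDerivAt_upper hz).nonpos_of_pos_left hz hzero hup
    have hp : W z * p z = z := by linarith
    rw [hzero] at hq
    simp only [mul_zero, zero_div] at hq
    rw [hq] at hd
    have : p z < 1 := by nlinarith
    have : 0 < p z := by nlinarith
    nlinarith
  · rw [hm] at hzero
    have hd := (h.hasDerivAt_lower hz).nonpos_of_pos_left hz hzero hlow
    obtain ⟨b, hb⟩ : ∃ b, b = z / W z := ⟨_, rfl⟩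
    have hzb : z = b * W z := by rw [hb]; field_simp
    have hb0 : 0 < b := by rw [hb]; positivity
    have hb1 : b < 1 := by rw [hb, div_lt_one hW]; exact hWz
    have hp : p z = b ^ 2 := by
      rw [hb]
      field_simp
      linarith
    have hq' : W z ^ 2 * q z = 3 * W z * (1 + b ^ 4) * (1 - b) := by
      have hz' := hz.ne'
      rw [hq, hp]
      field_simp
      generalize W z = w at *
      subst hzb
      ring
    have hfac : 2 * W z * p z ^ 2 + W z ^ 2 * q z - 2 * z
        = W z * ((1 - b) ^ 3 * (3 * b ^ 2 + 4 * b + 3)) := by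
      rw [hq', hp]
      generalize W z = w at *
      subst hzb
      ring
    have : 0 < 1 - b := by linarith
    have : 0 < W z * ((1 - b) ^ 3 * (3 * b ^ 2 + 4 * b + 3)) := by positivity
    linarith

lemma W_mul_p_lt (h : AlencarSolution W p q) {z : ℝ} (hz : 0 < z) : W z * p z < z := by
  linarith [(lt_min_iff.1 (h.barriers z hz)).1]

lemma sq_lt (h : AlencarSolution W p q) {z : ℝ} (hz : 0 < z) : z ^ 2 < W z ^ 2 * p z := by
  linarith [(lt_min_iff.1 (h.barriers z hz)).2]

lemma lt_W (h : AlencarSolution W p q) {z : ℝ} (hz : 0 < z) : z < W z :=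
  h.lt_of_lower_barrier hz fun x hx => by linarith [h.sq_lt hx.1]

lemma p_pos (h : AlencarSolution W p q) {z : ℝ} (hz : 0 < z) : 0 < p z :=
  pos_of_mul_pos_right ((by positivity : 0 < z ^ 2).trans (h.sq_lt hz)) (sq_nonneg _)

lemma p_lt_one (h : AlencarSolution W p q) {z : ℝ} (hz : 0 < z) : p z < 1 := by
  nlinarith [h.W_mul_p_lt hz, h.lt_W hz]

lemma q_pos (h : AlencarSolution W p q) {z : ℝ} (hz : 0 < z) : 0 < q z := by
  have h1 := h.pos z hz
  have h2 : 0 < z - W z * p z := by linarith [h.W_mul_p_lt hz]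
  rw [h.eqn z hz]
  positivity

lemma W_sub_mul_le_one (h : AlencarSolution W p q) {z : ℝ} (hz : 0 ≤ z) :
    W z - z * p z ≤ 1 := by
  have hanti : AntitoneOn (fun x => W x - x * p x) (Ici 0) := by
    refine antitoneOn_of_hasDerivWithinAt_nonpos (f' := fun x => -(x * q x)) (convex_Ici 0)
      (h.continuousOn.sub (continuousOn_id.mul h.continuousOn')) ?_ ?_
    · intro x hx
      rw [interior_Ici] at hx
      refine (((h.hasDerivAt x hx).sub
        ((hasDerivAt_id x).mul (h.hasDerivAt' x hx))).congr_deriv ?_).hasDerivWithinAt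
      simp
    · intro x hx
      rw [interior_Ici] at hx
      have := mul_pos hx (h.q_pos hx)
      linarith
  have := hanti self_mem_Ici hz hz
  simpa [h.W_zero] using this

/-- The nonlinear part of the equation is quadratic in `W / z - 1`. -/
lemma abs_nonlinearity_le (h : AlencarSolution W p q) {z : ℝ} (hz : 1 ≤ z) :
    |z * q z + 6 * (p z - 1) + 6 * (W z / z - 1)| ≤ 30 * (W z / z - 1) ^ 2 ∧
      -2 * (W z / z - 1) ≤ p z - 1 := by
  have hz0 : 0 < z := by linarith
  have hW := h.pos z hz0
  obtain ⟨w, hw⟩ : ∃ w, w = W z / z - 1 := ⟨_, rfl⟩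
  have hWw : W z = z * (1 + w) := by rw [hw]; field_simp; ring
  have hw0 : 0 < w := by
    have := h.lt_W hz0
    rw [hw, sub_pos, one_lt_div hz0]
    exact this
  obtain ⟨r, hr⟩ : ∃ r, r = p z - 1 := ⟨_, rfl⟩
  have hpr : p z = 1 + r := by rw [hr]; ring
  have hr0 : r < 0 := by linarith [h.p_lt_one hz0]
  have hr1 : -1 < r := by linarith [h.p_pos hz0]
  have hlow : 1 < (1 + w) ^ 2 * (1 + r) := by
    have := h.sq_lt hz0
    rw [hWw, hpr] at this
    have h2 : z ^ 2 * 1 < z ^ 2 * ((1 + w) ^ 2 * (1 + r)) := by linarith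
    exact lt_of_mul_lt_mul_left h2 (sq_nonneg z)
  have hr2 : -2 * w ≤ r := by
    by_contra! hc
    have h3 : (1 + w) ^ 2 * (1 + r) ≤ (1 + w) ^ 2 * (1 - 2 * w) := by
      gcongr
      linarith
    nlinarith [pow_pos hw0 2, pow_pos hw0 3]
  have hN : z * q z + 6 * (p z - 1) + 6 * (W z / z - 1)
      = 6 * w ^ 2 / (1 + w) - 3 * r * (2 + r) * (r + w / (1 + w)) := by
    rw [h.eqn z hz0, ← hw, hpr, hWw]
    field_simp
    ring
  have hs0 : 0 ≤ w / (1 + w) := by positivity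
  have hs1 : w / (1 + w) ≤ w := div_le_self hw0.le (by linarith)
  have ht0 : 0 ≤ 6 * w ^ 2 / (1 + w) := by positivity
  have ht1 : 6 * w ^ 2 / (1 + w) ≤ 6 * w ^ 2 := div_le_self (by positivity) (by linarith)
  have h1 : |3 * r * (2 + r) * (r + w / (1 + w))| ≤ 3 * (2 * w) * 2 * (2 * w) := by
    rw [abs_mul, abs_mul, abs_mul]
    gcongr
    · norm_num
    · rw [abs_le]; constructor <;> linarith
    · rw [abs_le]; constructor <;> linarith
    · rw [abs_le]; constructor <;> linarith
  rw [hN, ← hw, ← hr]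
  refine ⟨?_, hr2⟩
  rw [abs_le] at h1 ⊢
  constructor <;> nlinarith

lemma hasDerivAt_slow (h : AlencarSolution W p q) {z : ℝ} (hz : 0 < z) :
    HasDerivAt (fun z => z ^ 3 * (p z - 1) + 3 * z ^ 2 * (W z - z))
      (z ^ 2 * (z * q z + 6 * (p z - 1) + 6 * (W z / z - 1))) z := by
  refine (((hasDerivAt_pow 3 z).mul ((h.hasDerivAt' z hz).sub_const 1)).add
    (((hasDerivAt_pow 2 z).const_mul 3).mul
      ((h.hasDerivAt z hz).sub (hasDerivAt_id z)))).congr_deriv ?_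
  have := hz.ne'
  simp
  field_simp
  ring

lemma hasDerivAt_fast (h : AlencarSolution W p q) {z : ℝ} (hz : 0 < z) :
    HasDerivAt (fun z => z ^ 4 * (p z - 1) + 2 * z ^ 3 * (W z - z))
      (z ^ 3 * (z * q z + 6 * (p z - 1) + 6 * (W z / z - 1))) z := by
  refine (((hasDerivAt_pow 4 z).mul ((h.hasDerivAt' z hz).sub_const 1)).add
    (((hasDerivAt_pow 3 z).const_mul 2).mul
      ((h.hasDerivAt z hz).sub (hasDerivAt_id z)))).congr_deriv ?_
  have := hz.ne'
  simp
  field_simp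
  ring

lemma pow_mul_le_slow (h : AlencarSolution W p q) {z : ℝ} (hz : 1 ≤ z) :
    z ^ 3 * (W z / z - 1) ≤ z ^ 3 * (p z - 1) + 3 * z ^ 2 * (W z - z) := by
  have hz0 : 0 < z := by linarith
  have h1 : z ^ 3 * (p z - 1) + 3 * z ^ 2 * (W z - z)
      = z ^ 3 * ((p z - 1) + 3 * (W z / z - 1)) := by
    field_simp
  rw [h1]
  gcongr
  linarith [(h.abs_nonlinearity_le hz).2]

lemma exists_slow_le (h : AlencarSolution W p q) :
    ∃ M, 0 < M ∧ ∀ z ≥ 1, z ^ 3 * (p z - 1) + 3 * z ^ 2 * (W z - z) ≤ M := by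
  set y : ℝ → ℝ := fun z => z ^ 3 * (p z - 1) + 3 * z ^ 2 * (W z - z)
  have hw0 : ∀ z ≥ (1 : ℝ), 0 < W z / z - 1 := fun z hz => by
    rw [sub_pos, one_lt_div (by linarith)]
    exact h.lt_W (by linarith)
  have hpos : ∀ z ≥ (1 : ℝ), 0 < y z := fun z hz =>
    (mul_pos (by positivity) (hw0 z hz)).trans_le (h.pow_mul_le_slow hz)
  have hder : ∀ z ≥ (1 : ℝ), HasDerivAt (fun z => y z * Real.exp (30 * z⁻¹))
      ((z ^ 2 * (z * q z + 6 * (p z - 1) + 6 * (W z / z - 1))) * Real.exp (30 * z⁻¹)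
        + y z * (Real.exp (30 * z⁻¹) * (30 * -(z ^ 2)⁻¹))) z := fun z hz =>
    (h.hasDerivAt_slow (by linarith)).mul
      (((hasDerivAt_inv (by positivity)).const_mul 30).exp)
  have hanti : AntitoneOn (fun z => y z * Real.exp (30 * z⁻¹)) (Ici 1) := by
    refine antitoneOn_of_hasDerivWithinAt_nonpos (convex_Ici 1)
      (fun z hz => (hder z hz).continuousAt.continuousWithinAt)
      (fun z hz => (hder z (interior_subset hz)).hasDerivWithinAt) ?_
    intro z hz
    replace hz : (1 : ℝ) ≤ z := interior_subset hz
    have hz0 : 0 < z := by linarith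
    have hN := (le_abs_self _).trans (h.abs_nonlinearity_le hz).1
    have hwz : W z / z - 1 ≤ z⁻¹ := by
      have h1 := h.W_sub_mul_le_one hz0.le
      have h2 := h.p_lt_one hz0
      have h3 : W z ≤ 1 + z := by nlinarith
      calc W z / z - 1 ≤ (1 + z) / z - 1 := by gcongr
        _ = z⁻¹ := by field_simp; ring
    have hyw := h.pow_mul_le_slow hz
    have key : z ^ 2 * (z * q z + 6 * (p z - 1) + 6 * (W z / z - 1)) ≤ y z * (30 * (z ^ 2)⁻¹) :=
      calc _ ≤ z ^ 2 * (30 * (W z / z - 1) ^ 2) := by gcongr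
        _ = 30 * (z ^ 3 * (W z / z - 1)) * (W z / z - 1) * z⁻¹ := by field_simp
        _ ≤ 30 * y z * z⁻¹ * z⁻¹ := by
          have := (hw0 z hz).le
          have := (hpos z hz).le
          gcongr
        _ = _ := by field_simp
    have hE := Real.exp_pos (30 * z⁻¹)
    have := mul_le_mul_of_nonneg_right key hE.le
    linarith
  refine ⟨y 1 * Real.exp (30 * 1⁻¹), mul_pos (hpos 1 le_rfl) (Real.exp_pos _), fun z hz => ?_⟩
  refine le_trans ?_ (hanti self_mem_Ici hz hz)
  exact le_mul_of_one_le_right (hpos z hz).le (Real.one_le_exp (by positivity))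

lemma exists_asymptotics (h : AlencarSolution W p q) :
    ∃ Γ2 Γ3 C : ℝ, 0 < C ∧ ∀ z ≥ (1 : ℝ),
      |W z - z - Γ2 * z ^ (-2 : ℤ) - Γ3 * z ^ (-3 : ℤ)| ≤ C * z ^ (-5 : ℤ) := by
  obtain ⟨M, hM, hyM⟩ := h.exists_slow_le
  have hN : ∀ z ≥ (1 : ℝ), |z * q z + 6 * (p z - 1) + 6 * (W z / z - 1)|
      ≤ 30 * M ^ 2 * (z ^ 6)⁻¹ := by
    intro z hz
    have hz0 : 0 < z := by linarith
    have hw0 : 0 ≤ W z / z - 1 := by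
      rw [sub_nonneg, one_le_div hz0]
      exact (h.lt_W hz0).le
    have hw : W z / z - 1 ≤ M * (z ^ 3)⁻¹ := by
      rw [← div_eq_mul_inv, le_div_iff₀ (by positivity), mul_comm]
      exact (h.pow_mul_le_slow hz).trans (hyM z hz)
    calc _ ≤ 30 * (W z / z - 1) ^ 2 := (h.abs_nonlinearity_le hz).1
      _ ≤ 30 * (M * (z ^ 3)⁻¹) ^ 2 := by gcongr
      _ = _ := by field_simp
  obtain ⟨L, hL⟩ := exists_abs_sub_le_of_deriv_bound (c := 10 * M ^ 2) 3 (by positivity)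
    (fun z hz => h.hasDerivAt_slow (by linarith : 0 < z)) (by
      intro z hz
      have hz0 : 0 < z := by linarith
      rw [abs_mul, abs_of_pos (by positivity : 0 < z ^ 2)]
      refine (mul_le_mul_of_nonneg_left (hN z hz) (by positivity)).trans_eq ?_
      push_cast
      field_simp
      norm_num)
  obtain ⟨K, hK⟩ := exists_abs_sub_le_of_deriv_bound (c := 15 * M ^ 2) 2 (by positivity)
    (fun z hz => h.hasDerivAt_fast (by linarith : 0 < z)) (by
      intro z hz
      have hz0 : 0 < z := by linarith
      rw [abs_mul, abs_of_pos (by positivity : 0 < z ^ 3)]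
      refine (mul_le_mul_of_nonneg_left (hN z hz) (by positivity)).trans_eq ?_
      push_cast
      field_simp
      norm_num)
  refine ⟨L, -K, 25 * M ^ 2, by positivity, fun z hz => ?_⟩
  have hz0 : 0 < z := by linarith
  have hsplit : W z - z - L * z ^ (-2 : ℤ) - -K * z ^ (-3 : ℤ)
      = (z ^ 3 * (p z - 1) + 3 * z ^ 2 * (W z - z) - L) * (z ^ 2)⁻¹
        - (z ^ 4 * (p z - 1) + 2 * z ^ 3 * (W z - z) - K) * (z ^ 3)⁻¹ := by
    simp only [zpow_neg]
    norm_cast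
    field_simp
    ring
  rw [hsplit]
  refine (abs_sub _ _).trans ?_
  rw [abs_mul, abs_mul, abs_of_pos (by positivity : 0 < (z ^ 2)⁻¹),
    abs_of_pos (by positivity : 0 < (z ^ 3)⁻¹)]
  calc _ ≤ 10 * M ^ 2 * (z ^ 3)⁻¹ * (z ^ 2)⁻¹ + 15 * M ^ 2 * (z ^ 2)⁻¹ * (z ^ 3)⁻¹ := by
        gcongr
        · exact hL z hz
        · exact hK z hz
    _ = 25 * M ^ 2 * z ^ (-5 : ℤ) := by
        simp only [zpow_neg]
        norm_cast
        field_simp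
        norm_num

end AlencarSolution

/-- Properties of the Alencar solution with `W(0)=1`, `W'(0)=0`: convexity,
star-shapedness `0 ≤ W − z W' ≤ 1`, and the asymptotic expansion
`W(z) = z + Γ₂ z^{-2} + Γ₃ z^{-3} + O(z^{-5})`. -/
theorem stmt_15 (W : ℝ → ℝ)
    (hW : ContDiffOn ℝ (⊤ : ℕ∞) W (Set.Ici 0))
    (hWpos : ∀ z ≥ (0:ℝ), 0 < W z)
    (hAlencar : ∀ z > (0:ℝ),
      deriv (deriv W) z / (1 + (deriv W z) ^ 2) + (3 / z) * deriv W z - 3 / W z = 0)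
    (hW0 : W 0 = 1)
    (hW0' : derivWithin W (Set.Ici 0) 0 = 0)
    (hlim1 : Filter.Tendsto (fun z => W z / z) Filter.atTop (nhds 1))
    (hlim2 : Filter.Tendsto (deriv W) Filter.atTop (nhds 1)) :
    (∀ z > (0:ℝ), 0 < deriv (deriv W) z) ∧
    (∀ z ≥ (0:ℝ), 0 ≤ W z - z * deriv W z ∧ W z - z * deriv W z ≤ 1) ∧
    (∃ Γ2 Γ3 C : ℝ, 0 < C ∧ ∀ z ≥ (1:ℝ),
      |W z - z - Γ2 * z ^ (-2 : ℤ) - Γ3 * z ^ (-3 : ℤ)| ≤ C * z ^ (-5 : ℤ)) := by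
  set p : ℝ → ℝ := derivWithin W (Ici 0)
  set q : ℝ → ℝ := derivWithin p (Ici 0)
  have hpC : ContDiffOn ℝ (⊤ : ℕ∞) p (Ici 0) :=
    hW.derivWithin (uniqueDiffOn_Ici 0) (by simp)
  have hqC : ContDiffOn ℝ (⊤ : ℕ∞) q (Ici 0) :=
    hpC.derivWithin (uniqueDiffOn_Ici 0) (by simp)
  have hWd : ∀ z > (0 : ℝ), HasDerivAt W (p z) z := fun z hz =>
    ((hW.differentiableOn (by simp)) z (le_of_lt hz)).hasDerivWithinAt.hasDerivAt (Ici_mem_nhds hz)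
  have hpd : ∀ z > (0 : ℝ), HasDerivAt p (q z) z := fun z hz =>
    ((hpC.differentiableOn (by simp)) z (le_of_lt hz)).hasDerivWithinAt.hasDerivAt (Ici_mem_nhds hz)
  have hd1 : ∀ z > (0 : ℝ), deriv W z = p z := fun z hz => (hWd z hz).deriv
  have hd2 : ∀ z > (0 : ℝ), deriv (deriv W) z = q z := by
    intro z hz
    have : deriv W =ᶠ[nhds z] p := by
      filter_upwards [Ioi_mem_nhds hz] with x hx using hd1 x hx
    rw [this.deriv_eq, (hpd z hz).deriv]
  have h : AlencarSolution W p q :=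
    { pos := fun z hz => hWpos z (le_of_lt hz)
      hasDerivAt := hWd
      hasDerivAt' := hpd
      eqn := by
        intro z hz
        have hA := hAlencar z hz
        have hz' : z ≠ 0 := ne_of_gt hz
        have hW' := (hWpos z (le_of_lt hz)).ne'
        have hp' : (1 + p z ^ 2) ≠ 0 := by positivity
        rw [hd1 z hz, hd2 z hz] at hA
        field_simp at hA ⊢
        linarith
      W_zero := hW0
      p_zero := hW0'
      continuousOn := hW.continuousOn
      continuousOn' := hpC.continuousOn
      continuousOn'' := hqC.continuousOn
      hasDerivWithinAt_zero :=
        ((hpC.differentiableOn (by simp)) 0 self_mem_Ici).hasDerivWithinAt }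
  refine ⟨fun z hz => ?_, fun z hz => ?_, h.exists_asymptotics⟩
  · rw [hd2 z hz]
    exact h.q_pos hz
  · rcases hz.eq_or_lt with rfl | hz0
    · simp [hW0]
    · rw [hd1 z hz0]
      refine ⟨?_, h.W_sub_mul_le_one hz⟩
      nlinarith [h.p_lt_one hz0, h.lt_W hz0]
end
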